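/- Fix β₁, β₂ ∈ (0, π/2), δ ∈ (0, 1/12), κ > 0, σ > 0 and ρ > 0. For G > 0 large enough (so that the domain below is nonempty), let D = {v ∈ ℂ : |Im v| < −tan(β₁)·Re v + 1/3 − κG^{−3} and |Im v| > tan(β₂)·Re v + 1/6 − δ} and D_ρ = D ∩ {Re v > −ρ}; note that v + s ∈ D whenever v ∈ D and s ≤ 0. For h : D × ℝ → ℂ holomorphic in v, 2π-periodic and real-analytic in ξ (extending analytically to |Im ξ| < σ), with Fourier coefficients h^{[l]}(v) = (1/2π)∫₀^{2π} h(v,ξ)e^{−ilξ}dξ, define ‖h^{[l]}‖_{ν,μ} = sup_{v ∈ D∖D_ρ} |v|^{ν}|h^{[l]}(v)| + sup_{v ∈ D_ρ} |v² + 1/9|^{μ}|h^{[l]}(v)| and ‖h‖_{ν,μ} = Σ_{l∈ℤ} ‖h^{[l]}‖_{ν,μ} e^{|l|σ}. Define the operator 𝒢(h)(v,ξ) = ∫_{−∞}^{0} h(v + s, ξ + G³ s) ds. Then there exist K > 0 (depending only on ν, μ, β₁, β₂, δ, κ, σ, ρ, not on G) and G₀ such that for all G ≥ G₀: (i) for ν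 > 1 and μ > 1, if ‖h‖_{ν,μ} < ∞ then 𝒢(h) is well defined and holomorphic, satisfies (∂_v + G³∂_ξ)𝒢(h) = h, and ‖𝒢(h)‖_{ν−1,μ−1} ≤ K·‖h‖_{ν,μ}; (ii) for ν ≥ 1 and μ ≥ 1, if ‖h‖_{ν,μ} < ∞ then ‖∂_v 𝒢(h)‖_{ν,μ} ≤ K·‖h‖_{ν,μ}. -/

import Mathlib

/- STATEMENT 14: estimates for the left-inverse operator
`𝒢(h)(v,ξ) = ∫_{−∞}^0 h(v+s, ξ+G³s) ds` of `ℒ = ∂_v + G³∂_ξ` on the complex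
domain `D` approaching the singularities `±i/3`, in the weighted Fourier norms
`‖h‖_{ν,μ} = Σ_l ‖h^{[l]}‖_{ν,μ} e^{|l|σ}`. -/

open Real MeasureTheory
open scoped ENNReal

/-- The `l`-th Fourier coefficient of `h(v,·)`. -/
noncomputable def fourierCoefC (h : ℂ → ℝ → ℂ) (l : ℤ) (v : ℂ) : ℂ :=
  (1 / (2 * Real.pi) : ℂ) *
    ∫ ξ in (0 : ℝ)..(2 * Real.pi), h v ξ * Complex.exp (-Complex.I * l * ξ)

/-- The weighted norm `‖f‖_{ν,μ} = sup_{v ∈ D∖Dρ} |v|^ν |f v| + sup_{v ∈ Dρ} |v²+1/9|^μ |f v|`,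
with values in `[0,∞]`. -/
noncomputable def coefWNorm (D Dr : Set ℂ) (ν μ : ℝ) (f : ℂ → ℂ) : ℝ≥0∞ :=
  (⨆ v ∈ D \ Dr, ENNReal.ofReal (‖v‖ ^ ν * ‖f v‖)) +
  (⨆ v ∈ Dr, ENNReal.ofReal (‖v ^ 2 + 1 / 9‖ ^ μ * ‖f v‖))

/-- The weighted norm `‖h‖_{ν,μ} = Σ_{l∈ℤ} ‖h^{[l]}‖_{ν,μ} e^{|l|σ}`, valued in `[0,∞]`. -/
noncomputable def wNorm (D Dr : Set ℂ) (σ ν μ : ℝ) (h : ℂ → ℝ → ℂ) : ℝ≥0∞ :=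
  ∑' l : ℤ, coefWNorm D Dr ν μ (fourierCoefC h l) * ENNReal.ofReal (Real.exp (|(l : ℝ)| * σ))

/-- The unbounded complex domain `D^{∞,u}_{κ,δ}` reaching a `O(G⁻³)`-neighbourhood of
the singularities `±i/3` of the unperturbed homoclinic. -/
def domD (β₁ β₂ κ δ G : ℝ) : Set ℂ :=
  {v : ℂ | |v.im| < -Real.tan β₁ * v.re + 1 / 3 - κ / G ^ 3 ∧
           Real.tan β₂ * v.re + 1 / 6 - δ < |v.im|}

/-- The bounded subdomain `D_{ρ,κ,δ} = D ∩ {Re v > −ρ}`. -/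
def domDr (β₁ β₂ κ δ G ρ : ℝ) : Set ℂ :=
  domD β₁ β₂ κ δ G ∩ {v : ℂ | -ρ < v.re}

/-- The left-inverse operator `𝒢(h)(v,ξ) = ∫_{−∞}^0 h(v+s, ξ+G³s) ds`. -/
noncomputable def Gop (G : ℝ) (h : ℂ → ℝ → ℂ) (v : ℂ) (ξ : ℝ) : ℂ :=
  ∫ s in Set.Iic (0 : ℝ), h (v + (s : ℂ)) (ξ + G ^ 3 * s)

/-! ### Geometry of the domain -/

/-- The cone of the directions `s` with `|Im s| ≤ -m Re s`. -/
def leftCone (m : ℝ) : Set ℂ := {s | |s.im| ≤ -m * s.re}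

/-- The region below the two lines through `±i/3`. -/
def roofRegion (t : ℝ) : Set ℂ := {v | |v.im| < 1 / 3 - t * v.re}

/-- The weight defining `coefWNorm`, as a single function. -/
noncomputable def wt (ρ ν μ : ℝ) (v : ℂ) : ℝ :=
  if v.re ≤ -ρ then ‖v‖ ^ ν else ‖v ^ 2 + 1 / 9‖ ^ μ

lemma wt_of_le {ρ ν μ : ℝ} {v : ℂ} (h : v.re ≤ -ρ) : wt ρ ν μ v = ‖v‖ ^ ν := if_pos h

lemma wt_of_lt {ρ ν μ : ℝ} {v : ℂ} (h : -ρ < v.re) :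
    wt ρ ν μ v = ‖v ^ 2 + 1 / 9‖ ^ μ := if_neg (not_le.2 h)

lemma wt_nonneg (ρ ν μ : ℝ) (v : ℂ) : 0 ≤ wt ρ ν μ v := by
  unfold wt; split_ifs <;> positivity

lemma re_nonpos_of_mem_leftCone {m : ℝ} (hm : 0 < m) {s : ℂ} (hs : s ∈ leftCone m) :
    s.re ≤ 0 := by
  have h : |s.im| ≤ -m * s.re := hs
  nlinarith [abs_nonneg s.im]

lemma ofReal_mem_leftCone {m s : ℝ} (hm : 0 < m) (hs : s ≤ 0) : (s : ℂ) ∈ leftCone m := by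
  have : 0 ≤ -m * s := by nlinarith
  simpa [leftCone] using this

/-- The aperture of a ball about a negative real number inside the cone `leftCone m`. -/
lemma mem_leftCone_of_norm_sub_le {m : ℝ} (hm : 0 < m) {t : ℝ} {z : ℂ}
    (hz : ‖z + t‖ ≤ m / (1 + m) * t) :
    z ∈ leftCone m ∧ z.re ≤ -(1 / (1 + m) * t) := by
  have h1 : |z.re + t| ≤ m / (1 + m) * t := by
    simpa using (Complex.abs_re_le_norm (z + t)).trans hz
  have h2 : |z.im| ≤ m / (1 + m) * t := by
    simpa using (Complex.abs_im_le_norm (z + t)).trans hz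
  have h3 : z.re ≤ -(1 / (1 + m) * t) := by
    have h4 := (abs_le.1 h1).2
    have : t = 1 / (1 + m) * t + m / (1 + m) * t := by field_simp
    linarith
  refine ⟨?_, h3⟩
  have h5 : m * z.re ≤ m * -(1 / (1 + m) * t) := mul_le_mul_of_nonneg_left h3 hm.le
  have h6 : m / (1 + m) * t = m * (1 / (1 + m) * t) := by ring
  change |z.im| ≤ -m * z.re
  linarith

lemma norm_leftCone_le {m : ℝ} (hm : 0 < m) {s : ℂ} (hs : s ∈ leftCone m) :
    ‖s‖ ≤ (1 + m) * -s.re := by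
  have h1 : |s.im| ≤ -m * s.re := hs
  have := Complex.norm_le_abs_re_add_abs_im s
  rw [abs_of_nonpos (re_nonpos_of_mem_leftCone hm hs)] at this
  linarith

lemma norm_leftCone_le_norm_add_sub {t m : ℝ} (ht : 0 < t) (hm : 0 < m) (hmt : m ≤ t / 2)
    {v s p : ℂ} (hv : v ∈ roofRegion t) (hs : s ∈ leftCone m)
    (hp : p.re = 0) (hp' : |p.im| = 1 / 3) :
    ‖s‖ ≤ 2 * (1 + m) * (1 + t) / t * ‖v + s - p‖ := by
  have h1 : |v.im| < 1 / 3 - t * v.re := hv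
  have h2 : |s.im| ≤ -m * s.re := hs
  have h0 := re_nonpos_of_mem_leftCone hm hs
  have h3 : t / 2 * (-s.re) ≤ (1 + t) * ‖v + s - p‖ := by
    have ha := Complex.abs_re_le_norm (v + s - p)
    have hb := Complex.abs_im_le_norm (v + s - p)
    simp only [Complex.sub_re, Complex.add_re, Complex.sub_im, Complex.add_im, hp, sub_zero]
      at ha hb
    have hc := abs_sub_abs_le_abs_sub p.im (v.im + s.im)
    rw [abs_sub_comm p.im] at hc
    have hd := abs_add_le v.im s.im
    have he := neg_abs_le (v.re + s.re)
    have hf : t * -(v.re + s.re) ≤ t * ‖v + s - p‖ :=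
      mul_le_mul_of_nonneg_left (by linarith [neg_le_abs (v.re + s.re)]) ht.le
    have hg : t * (v.re + s.re) ≤ t * ‖v + s - p‖ :=
      mul_le_mul_of_nonneg_left (by linarith [le_abs_self (v.re + s.re)]) ht.le
    nlinarith
  have h4 := norm_leftCone_le hm hs
  rw [div_mul_eq_mul_div, le_div_iff₀ ht]
  have h5 : (1 + m) * (t / 2 * (-s.re)) ≤ (1 + m) * ((1 + t) * ‖v + s - p‖) :=
    mul_le_mul_of_nonneg_left h3 (by linarith)
  nlinarith

lemma sq_add_ninth (w : ℂ) :
    w ^ 2 + 1 / 9 = (w - Complex.I / 3) * (w - -(Complex.I / 3)) := by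
  linear_combination ((1 / 9) : ℂ) * Complex.I_sq

lemma norm_sq_add_ninth_le {t m : ℝ} (ht : 0 < t) (hm : 0 < m) (hmt : m ≤ t / 2) :
    ∃ C : ℝ, 1 ≤ C ∧ ∀ v ∈ roofRegion t, ∀ s ∈ leftCone m,
      ‖v ^ 2 + 1 / 9‖ ≤ C * ‖(v + s) ^ 2 + 1 / 9‖ ∧ ‖s‖ ≤ C * ‖(v + s) ^ 2 + 1 / 9‖ := by
  set A := 2 * (1 + m) * (1 + t) / t with hA
  have hA0 : 0 < A := by positivity
  refine ⟨(1 + A) ^ 2 + 3 * A, by nlinarith, fun v hv s hs => ?_⟩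
  have key : ∀ p : ℂ, p.re = 0 → |p.im| = 1 / 3 →
      ‖s‖ ≤ A * ‖v + s - p‖ ∧ ‖v - p‖ ≤ (1 + A) * ‖v + s - p‖ := by
    intro p hp hp'
    have h := norm_leftCone_le_norm_add_sub ht hm hmt hv hs hp hp'
    refine ⟨h, ?_⟩
    have : v - p = (v + s - p) - s := by ring
    rw [this]
    exact (norm_sub_le _ _).trans (by linarith)
  have hp1 := key (Complex.I / 3) (by simp) (by simp)
  have hp2 := key (-(Complex.I / 3)) (by simp) (by simp)
  rw [sq_add_ninth, sq_add_ninth, norm_mul, norm_mul]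
  set a := ‖v + s - Complex.I / 3‖
  set b := ‖v + s - -(Complex.I / 3)‖
  have ha : 0 ≤ a := norm_nonneg _
  have hb : 0 ≤ b := norm_nonneg _
  have hab : 2 / 3 ≤ a + b := by
    have h1 : ‖(v + s - -(Complex.I / 3)) - (v + s - Complex.I / 3)‖ = 2 / 3 := by
      have : (v + s - -(Complex.I / 3)) - (v + s - Complex.I / 3) = (2 / 3 : ℝ) * Complex.I := by
        push_cast; ring
      rw [this, norm_mul, Complex.norm_I, mul_one, Complex.norm_real]
      norm_num
    have h2 := norm_sub_le (v + s - -(Complex.I / 3)) (v + s - Complex.I / 3)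
    rw [h1] at h2
    linarith
  have hab0 : 0 ≤ a * b := mul_nonneg ha hb
  constructor
  · calc _ ≤ (1 + A) * a * ((1 + A) * b) :=
          mul_le_mul hp1.2 hp2.2 (norm_nonneg _) (by positivity)
      _ = (1 + A) ^ 2 * (a * b) := by ring
      _ ≤ _ := by nlinarith
  · have h3 : ‖s‖ ≤ 3 * A * (a * b) := by
      rcases le_or_gt (1 / 3) a with h | h
      · have : 1 / 3 * b ≤ a * b := mul_le_mul_of_nonneg_right h hb
        nlinarith [hp2.1]
      · have : a * (1 / 3) ≤ a * b := mul_le_mul_of_nonneg_left (by linarith) ha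
        nlinarith [hp1.1]
    nlinarith [sq_nonneg (1 + A)]

lemma norm_sq_add_ninth_pos {t : ℝ} {v : ℂ} (hv : v ∈ roofRegion t) : 0 < ‖v ^ 2 + 1 / 9‖ := by
  have h1 : |v.im| < 1 / 3 - t * v.re := hv
  rw [norm_pos_iff, sq_add_ninth, mul_ne_zero_iff, sub_ne_zero, sub_ne_zero]
  constructor <;> rintro rfl <;> simp at h1

lemma norm_le_of_neg_lt_re {t ρ : ℝ} (ht : 0 < t) (hρ : 0 < ρ) :
    ∃ B : ℝ, 1 ≤ B ∧ ∀ v ∈ roofRegion t, -ρ < v.re → ‖v‖ ≤ B ∧ ‖v ^ 2 + 1 / 9‖ ≤ B := by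
  set A := ρ + 1 / (3 * t) + 1 / 3 + t * ρ with hA
  have hA0 : 0 ≤ A := by positivity
  refine ⟨A ^ 2 + A + 1, by nlinarith, fun v hv hre => ?_⟩
  have h1 : |v.im| < 1 / 3 - t * v.re := hv
  have h2 : v.re ≤ 1 / (3 * t) := by
    rw [le_div_iff₀ (by positivity)]
    nlinarith [abs_nonneg v.im]
  have h3 : |v.re| ≤ ρ + 1 / (3 * t) := by
    have : 0 < 1 / (3 * t) := by positivity
    rw [abs_le]; constructor <;> linarith
  have h4 : ‖v‖ ≤ A := by
    have := Complex.norm_le_abs_re_add_abs_im v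
    nlinarith
  refine ⟨by nlinarith, ?_⟩
  have h5 : ‖v ^ 2 + 1 / 9‖ ≤ ‖v‖ ^ 2 + 1 / 9 := by
    refine (norm_add_le _ _).trans ?_
    rw [norm_pow]
    norm_num
  nlinarith [norm_nonneg v]

lemma norm_le_mul_neg_re {t ρ : ℝ} (hρ : 0 < ρ) {v : ℂ} (hv : v ∈ roofRegion t)
    (hre : v.re ≤ -ρ) : ‖v‖ ≤ (1 + t + 1 / (3 * ρ)) * -v.re := by
  have h1 : |v.im| < 1 / 3 - t * v.re := hv
  have h2 := Complex.norm_le_abs_re_add_abs_im v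
  rw [abs_of_nonpos (by linarith)] at h2
  have h3 : 1 / 3 ≤ 1 / (3 * ρ) * -v.re := by
    rw [div_mul_eq_mul_div, le_div_iff₀ (by positivity)]
    linarith
  linarith

lemma wt_pos {t ρ ν μ : ℝ} (hρ : 0 < ρ) {v : ℂ} (hv : v ∈ roofRegion t) : 0 < wt ρ ν μ v := by
  unfold wt
  split_ifs with h
  · refine Real.rpow_pos_of_pos ?_ _
    rw [norm_pos_iff]
    rintro rfl
    simp at h
    linarith
  · exact Real.rpow_pos_of_pos (norm_sq_add_ninth_pos hv) _

lemma wt_le_mul_wt_add {t m ρ ν μ : ℝ} (ht : 0 < t) (hm : 0 < m) (hmt : m ≤ t / 2) (hρ : 0 < ρ)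
    (hν : 0 ≤ ν) (hμ : 0 ≤ μ) :
    ∃ C : ℝ, 0 < C ∧ ∀ v ∈ roofRegion t, ∀ s ∈ leftCone m,
      wt ρ ν μ v ≤ C * wt ρ ν μ (v + s) := by
  obtain ⟨A, hA1, hA⟩ := norm_sq_add_ninth_le ht hm hmt
  obtain ⟨B, hB1, hB⟩ := norm_le_of_neg_lt_re ht hρ
  set E := 1 + t + 1 / (3 * ρ) with hE
  have hE0 : 0 < E := by positivity
  refine ⟨A ^ μ + E ^ ν + B ^ μ * ρ⁻¹ ^ ν, by positivity, fun v hv s hs => ?_⟩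
  have h0 := re_nonpos_of_mem_leftCone hm hs
  have e1 : 0 ≤ A ^ μ := by positivity
  have e2 : 0 ≤ E ^ ν := by positivity
  have e3 : 0 ≤ B ^ μ * ρ⁻¹ ^ ν := by positivity
  have hw := wt_nonneg ρ ν μ (v + s)
  rcases le_or_gt v.re (-ρ) with h | h
  · have h' : (v + s).re ≤ -ρ := by simp only [Complex.add_re]; linarith
    have h3 : ‖v‖ ≤ E * ‖v + s‖ := by
      refine (norm_le_mul_neg_re hρ hv h).trans (mul_le_mul_of_nonneg_left ?_ hE0.le)
      have := (neg_le_abs _).trans (Complex.abs_re_le_norm (v + s))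
      simp only [Complex.add_re] at this
      linarith
    have h4 : wt ρ ν μ v ≤ E ^ ν * wt ρ ν μ (v + s) := by
      rw [wt_of_le h, wt_of_le h', ← Real.mul_rpow hE0.le (norm_nonneg _)]
      exact Real.rpow_le_rpow (norm_nonneg _) h3 hν
    nlinarith
  · rcases le_or_gt (v + s).re (-ρ) with h' | h'
    · have h3 : ρ ≤ ‖v + s‖ := by
        have := (neg_le_abs _).trans (Complex.abs_re_le_norm (v + s))
        linarith
      have h4 : wt ρ ν μ v ≤ (B ^ μ * ρ⁻¹ ^ ν) * wt ρ ν μ (v + s) := by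
        rw [wt_of_lt h, wt_of_le h', mul_assoc, ← Real.mul_rpow (by positivity) (norm_nonneg _)]
        have h5 : 1 ≤ (ρ⁻¹ * ‖v + s‖) ^ ν := by
          refine Real.one_le_rpow ?_ hν
          rw [inv_mul_eq_div, le_div_iff₀ hρ]
          linarith
        have h6 : ‖v ^ 2 + 1 / 9‖ ^ μ ≤ B ^ μ :=
          Real.rpow_le_rpow (norm_nonneg _) (hB v hv h).2 hμ
        have : 0 ≤ B ^ μ := by positivity
        nlinarith
      nlinarith
    · have h4 : wt ρ ν μ v ≤ A ^ μ * wt ρ ν μ (v + s) := by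
        rw [wt_of_lt h, wt_of_lt h', ← Real.mul_rpow (by positivity) (norm_nonneg _)]
        exact Real.rpow_le_rpow (norm_nonneg _) (hA v hv s hs).1 hμ
      nlinarith

lemma one_sub_re_le_mul_norm_add {ρ : ℝ} (hρ : 0 < ρ) {v s : ℂ} {B : ℝ} (hB : |v.re| ≤ B)
    (h : (v + s).re ≤ -ρ) : 1 - s.re ≤ ((1 + B) / ρ + 1) * ‖v + s‖ := by
  have h1 := (neg_le_abs _).trans (Complex.abs_re_le_norm (v + s))
  have h2 : ρ ≤ ‖v + s‖ := by linarith
  have h3 : 1 + B ≤ (1 + B) / ρ * ‖v + s‖ := by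
    rw [div_mul_eq_mul_div, le_div_iff₀ hρ]
    exact mul_le_mul_of_nonneg_left h2 (by linarith [abs_nonneg v.re])
  simp only [Complex.add_re] at h1
  have := le_abs_self v.re
  linarith

lemma rpow_one_sub_re_le_mul_wt {t m ρ ν μ : ℝ} (ht : 0 < t) (hm : 0 < m) (hmt : m ≤ t / 2)
    (hρ : 0 < ρ) (hν : 0 ≤ ν) (hμ : 0 ≤ μ) {v : ℂ} (hv : v ∈ roofRegion t) :
    ∃ C : ℝ, 0 < C ∧ ∀ s ∈ leftCone m, (1 - s.re) ^ ν ≤ C * wt ρ ν μ (v + s) := by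
  obtain ⟨A, hA0, hA⟩ := wt_le_mul_wt_add (ρ := ρ) (ν := ν) (μ := μ) ht hm hmt hρ hν hμ
  have hw0 : 0 < wt ρ ν μ v := wt_pos hρ hv
  set E := (1 + |v.re|) / ρ + 1
  have hE : 0 < E := by positivity
  set L := (1 + ρ + |v.re|) ^ ν * (A / wt ρ ν μ v)
  have hL : 0 ≤ L := by positivity
  refine ⟨E ^ ν + L, by positivity, fun s hs => ?_⟩
  have h0 := re_nonpos_of_mem_leftCone hm hs
  have hw := wt_nonneg ρ ν μ (v + s)
  have hEν : 0 ≤ E ^ ν := by positivity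
  rcases le_or_gt (v + s).re (-ρ) with h | h
  · have h1 := Real.rpow_le_rpow (by linarith) (one_sub_re_le_mul_norm_add hρ le_rfl h) hν
    rw [Real.mul_rpow hE.le (norm_nonneg _), ← wt_of_le (μ := μ) h] at h1
    nlinarith
  · have h1 : (1 - s.re) ^ ν ≤ (1 + ρ + |v.re|) ^ ν := by
      refine Real.rpow_le_rpow (by linarith) ?_ hν
      simp only [Complex.add_re] at h
      linarith [le_abs_self v.re]
    have h2 : (1 - s.re) ^ ν ≤ L * wt ρ ν μ (v + s) := by
      refine h1.trans ?_
      rw [mul_assoc]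
      refine le_mul_of_one_le_right (by positivity) ?_
      rw [div_mul_eq_mul_div, le_div_iff₀ hw0, one_mul]
      exact hA v hv s hs
    nlinarith

lemma integrableOn_rpow_sub {a p : ℝ} (ha : 0 < a) (hp : 1 < p) :
    IntegrableOn (fun s : ℝ => (a - s) ^ (-p)) (Set.Iic 0) := by
  have h := integrableOn_Ioi_rpow_of_lt (a := -p) (by linarith) (half_pos ha)
  have h' := (integrable_indicator_iff measurableSet_Ioi).2 h
  have h2 := h'.comp_sub_left a
  refine (h2.integrableOn (s := Set.Iic 0)).congr_fun (fun s hs => ?_) measurableSet_Iic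
  have hs' : s ≤ 0 := hs
  simp only [Set.indicator]
  rw [if_pos]
  simp only [Set.mem_Ioi]; linarith

lemma integral_rpow_sub {a p : ℝ} (ha : 0 < a) (hp : 1 < p) :
    ∫ s in Set.Iic (0 : ℝ), (a - s) ^ (-p) = a ^ (1 - p) / (p - 1) := by
  have h : ∫ s in Set.Iic (0 : ℝ), (a - s) ^ (-p) = ∫ s in Set.Ioi a, s ^ (-p) := by
    rw [← integral_Ici_eq_integral_Ioi, ← integral_indicator measurableSet_Iic,
      ← integral_indicator measurableSet_Ici, ← integral_sub_left_eq_self _ volume a]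
    refine integral_congr_ae (.of_forall fun s => ?_)
    simp [Set.indicator]
  rw [h, integral_Ioi_rpow_of_lt (by linarith) ha, show -p + 1 = -(p - 1) by ring,
    show 1 - p = -(p - 1) by ring, neg_div_neg_eq]

lemma exists_integrable_majorant {t ρ ν μ : ℝ} (ht : 0 < t) (hρ : 0 < ρ)
    (hν : 1 < ν) (hμ : 1 < μ) :
    ∃ K : ℝ, 0 < K ∧ ∀ v ∈ roofRegion t, ∃ g : ℝ → ℝ, IntegrableOn g (Set.Iic 0) ∧
      (∀ s : ℝ, s ≤ 0 → 1 ≤ g s * wt ρ ν μ (v + s)) ∧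
      wt ρ (ν - 1) (μ - 1) v * ∫ s in Set.Iic (0 : ℝ), g s ≤ K := by
  obtain ⟨A, hA1, hA⟩ := norm_sq_add_ninth_le ht (half_pos ht) le_rfl
  obtain ⟨B, hB1, hB⟩ := norm_le_of_neg_lt_re ht hρ
  have hν1 : 0 < ν - 1 := by linarith
  have hμ1 : 0 < μ - 1 := by linarith
  set E := 1 + t + 1 / (3 * ρ) with hE
  have hE0 : 0 < E := by positivity
  set F := (1 + B) / ρ + 1 with hF
  have hF0 : 0 < F := by positivity
  have k1 : 0 < E ^ (ν - 1) / (ν - 1) := by positivity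
  have k2 : 0 < (2 * A) ^ μ / (μ - 1) + B ^ (μ - 1) * (F ^ ν / (ν - 1)) := by positivity
  refine ⟨E ^ (ν - 1) / (ν - 1) + ((2 * A) ^ μ / (μ - 1) + B ^ (μ - 1) * (F ^ ν / (ν - 1))),
    by positivity, fun v hv => ?_⟩
  have one_le : ∀ {x y p : ℝ}, 0 < x → x ≤ y → 0 < p → 1 ≤ x ^ (-p) * y ^ p := by
    intro x y p hx hxy hp
    rw [Real.rpow_neg hx.le, inv_mul_eq_div, one_le_div (by positivity)]
    exact Real.rpow_le_rpow hx.le hxy hp.le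
  rcases le_or_gt v.re (-ρ) with h | h
  · have hv0 : 0 < ‖v‖ := by
      have := (neg_le_abs _).trans (Complex.abs_re_le_norm v)
      linarith
    have ha : 0 < ‖v‖ / E := by positivity
    refine ⟨fun s => (‖v‖ / E - s) ^ (-ν), integrableOn_rpow_sub ha hν, fun s hs => ?_, ?_⟩
    · have h' : (v + s).re ≤ -ρ := by simp; linarith
      rw [wt_of_le h']
      refine one_le (by linarith) ?_ (by linarith)
      have h1 := (neg_le_abs _).trans (Complex.abs_re_le_norm (v + s))
      have h2 : ‖v‖ / E ≤ -v.re := by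
        rw [div_le_iff₀ hE0, mul_comm]
        exact norm_le_mul_neg_re hρ hv h
      simp only [Complex.add_re, Complex.ofReal_re] at h1
      linarith
    · rw [integral_rpow_sub ha hν, wt_of_le h, Real.div_rpow hv0.le hE0.le,
        show (1 : ℝ) - ν = -(ν - 1) by ring, Real.rpow_neg hv0.le, Real.rpow_neg hE0.le]
      have : 0 < ‖v‖ ^ (ν - 1) := by positivity
      have : ‖v‖ ^ (ν - 1) * ((‖v‖ ^ (ν - 1))⁻¹ / (E ^ (ν - 1))⁻¹ / (ν - 1))
          = E ^ (ν - 1) / (ν - 1) := by field_simp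
      linarith
  · have hq := norm_sq_add_ninth_pos hv
    have hBv := hB v hv h
    set q := ‖v ^ 2 + 1 / 9‖
    have i1 := (integrableOn_rpow_sub hq hμ).const_mul ((2 * A) ^ μ)
    have i2 := (integrableOn_rpow_sub one_pos hν).const_mul (F ^ ν)
    refine ⟨fun s => (2 * A) ^ μ * (q - s) ^ (-μ) + F ^ ν * (1 - s) ^ (-ν), i1.add i2,
      fun s hs => ?_, ?_⟩
    · have hs' : (s : ℂ) ∈ leftCone (t / 2) := ofReal_mem_leftCone (half_pos ht) hs
      have n1 : 0 ≤ (q - s) ^ (-μ) := Real.rpow_nonneg (by linarith) _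
      have n2 : 0 ≤ (1 - s) ^ (-ν) := Real.rpow_nonneg (by linarith) _
      have n3 : 0 ≤ (2 * A) ^ μ := by positivity
      have n4 : 0 ≤ F ^ ν := by positivity
      have n5 := wt_nonneg ρ ν μ (v + s)
      rcases le_or_gt (v + s).re (-ρ) with h' | h'
      · have h1 := one_sub_re_le_mul_norm_add hρ
          ((Complex.abs_re_le_norm v).trans hBv.1) h'
        rw [Complex.ofReal_re] at h1
        have h2 := one_le (x := 1 - s) (by linarith) h1 (by linarith : 0 < ν)
        rw [Real.mul_rpow hF0.le (norm_nonneg _), ← wt_of_le (μ := μ) h'] at h2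
        have : 0 ≤ (2 * A) ^ μ * (q - s) ^ (-μ) * wt ρ ν μ (v + s) := by positivity
        linarith
      · have h0 := hA v hv s hs'
        have h1 : q - s ≤ 2 * A * ‖(v + s) ^ 2 + 1 / 9‖ := by
          have := h0.2
          rw [Complex.norm_real, Real.norm_of_nonpos hs] at this
          linarith [h0.1]
        have h2 := one_le (x := q - s) (by linarith) h1 (by linarith : 0 < μ)
        rw [Real.mul_rpow (by positivity) (norm_nonneg _), ← wt_of_lt (ν := ν) h'] at h2
        have : 0 ≤ F ^ ν * (1 - s) ^ (-ν) * wt ρ ν μ (v + s) := by positivity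
        linarith
    · rw [integral_add i1 i2, integral_const_mul, integral_const_mul, integral_rpow_sub hq hμ,
        integral_rpow_sub one_pos hν, wt_of_lt h, Real.one_rpow,
        show (1 : ℝ) - μ = -(μ - 1) by ring, Real.rpow_neg hq.le]
      have hq' : 0 < q ^ (μ - 1) := by positivity
      have e1 : q ^ (μ - 1) * ((2 * A) ^ μ * ((q ^ (μ - 1))⁻¹ / (μ - 1)))
          = (2 * A) ^ μ / (μ - 1) := by field_simp
      have e2 : q ^ (μ - 1) * (F ^ ν * (1 / (ν - 1))) ≤ B ^ (μ - 1) * (F ^ ν / (ν - 1)) := by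
        rw [mul_one_div]
        exact mul_le_mul_of_nonneg_right (Real.rpow_le_rpow hq.le hBv.2 hμ1.le) (by positivity)
      change q ^ (μ - 1) * _ ≤ _
      rw [mul_add]
      linarith

/-! ### Holomorphic functions on a domain invariant under a cone of translations -/

/-- `D` is stable under translation by `leftCone m`, and `w` is a positive weight on `D` that
grows at least like `|s|^ν`, and that up to the factor `C` does not decrease, along the cone. -/
structure IsConeWeight (D : Set ℂ) (m ν C : ℝ) (w : ℂ → ℝ) : Prop where
  isOpen : IsOpen D
  slope_pos : 0 < m
  exponent_pos : 0 < ν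
  const_pos : 0 < C
  add_mem : ∀ v ∈ D, ∀ s ∈ leftCone m, v + s ∈ D
  pos : ∀ v ∈ D, 0 < w v
  le_mul : ∀ v ∈ D, ∀ s ∈ leftCone m, w v ≤ C * w (v + s)
  decay : ∀ v ∈ D, ∃ B : ℝ, 0 < B ∧ ∀ s ∈ leftCone m, (1 - s.re) ^ ν ≤ B * w (v + s)

lemma norm_deriv_le_of_closedBall {D : Set ℂ} {f : ℂ → ℂ} (hf : DifferentiableOn ℂ f D)
    {c : ℂ} {R A : ℝ} (hR : 0 < R) (hD : Metric.closedBall c R ⊆ D)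
    (hA : ∀ z ∈ Metric.closedBall c R, ‖f z‖ ≤ A) (n : ℕ) :
    ‖iteratedDeriv n f c‖ ≤ n.factorial * A / R ^ n :=
  Complex.norm_iteratedDeriv_le_of_forall_mem_sphere_norm_le n hR
    ((hf.mono hD).diffContOnCl_ball subset_rfl)
    fun z hz => hA z (Metric.sphere_subset_closedBall hz)

namespace IsConeWeight

variable {D : Set ℂ} {m ν C : ℝ} {w : ℂ → ℝ}

lemma add_ofReal_mem (hw : IsConeWeight D m ν C w) {v : ℂ} (hv : v ∈ D) {s : ℝ} (hs : s ≤ 0) :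
    v + s ∈ D := hw.add_mem v hv s (ofReal_mem_leftCone hw.slope_pos hs)

lemma exists_local_bounds (hw : IsConeWeight D m ν C w) {v₀ : ℂ} (hv₀ : v₀ ∈ D) :
    ∃ ε : ℝ, 0 < ε ∧ ∃ B : ℝ, 0 < B ∧ Metric.ball v₀ ε ⊆ D ∧
      ∀ (f : ℂ → ℂ) (M : ℝ), DifferentiableOn ℂ f D → (∀ v ∈ D, w v * ‖f v‖ ≤ M) →
        ∀ z ∈ Metric.ball v₀ ε, ∀ s : ℝ, s ≤ 0 →
          ‖f (z + s)‖ ≤ B * M * (1 - s) ^ (-ν) ∧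
          ‖deriv f (z + s)‖ ≤ B * M * (1 - s) ^ (-ν - 1) := by
  have hm := hw.slope_pos
  have hν := hw.exponent_pos
  obtain ⟨η, hη, hη1, hηD⟩ : ∃ η : ℝ, 0 < η ∧ η ≤ 1 ∧ v₀ + (η : ℂ) ∈ D := by
    obtain ⟨e, he, heD⟩ := Metric.isOpen_iff.1 hw.isOpen v₀ hv₀
    refine ⟨min 1 (e / 2), by positivity, min_le_left _ _, heD ?_⟩
    rw [mem_ball_iff_norm, add_sub_cancel_left, Complex.norm_real,
      Real.norm_of_nonneg (by positivity)]
    exact (min_le_right _ _).trans_lt (by linarith)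
  obtain ⟨B, hB, hBw⟩ := hw.decay _ hηD
  set r := m / (1 + m) with hr
  have hr0 : 0 < r := by positivity
  have cone : ∀ z ∈ Metric.ball v₀ (r * η / 2), ∀ s : ℝ, s ≤ 0 →
      ∀ x ∈ Metric.closedBall (z + s) (r * (η / 2 - s)),
        x - (v₀ + η) ∈ leftCone m ∧ (x - (v₀ + η)).re ≤ -(1 / (1 + m) * (η - s)) := by
    intro z hz s hs x hx
    apply mem_leftCone_of_norm_sub_le hm
    rw [mem_ball_iff_norm] at hz
    rw [mem_closedBall_iff_norm] at hx
    have : x - (v₀ + η) + ((η - s : ℝ) : ℂ) = (x - (z + s)) + (z - v₀) := by push_cast; ring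
    rw [this]
    refine (norm_add_le _ _).trans ?_
    change _ ≤ r * (η - s)
    linarith
  have memD : ∀ z ∈ Metric.ball v₀ (r * η / 2), ∀ s : ℝ, s ≤ 0 →
      Metric.closedBall (z + s) (r * (η / 2 - s)) ⊆ D := by
    intro z hz s hs x hx
    have := hw.add_mem _ hηD _ (cone z hz s hs x hx).1
    rwa [add_sub_cancel] at this
  have hε : 0 < r * η / 2 := by positivity
  set ε := r * η / 2 with hεdef
  refine ⟨ε, hε, B * (1 + m) ^ ν * (1 + 1 / ε), by positivity, ?_, ?_⟩
  · intro z hz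
    refine memD z hz 0 le_rfl ?_
    rw [Complex.ofReal_zero, add_zero]
    exact Metric.mem_closedBall_self (by rw [sub_zero]; positivity)
  intro f M hf hM z hz s hs
  have hM0 : 0 ≤ M := le_trans (mul_nonneg (hw.pos _ hv₀).le (norm_nonneg _)) (hM _ hv₀)
  have hs1 : 0 < 1 - s := by linarith
  have bound : ∀ x ∈ Metric.closedBall (z + s) (r * (η / 2 - s)),
      ‖f x‖ ≤ B * (1 + m) ^ ν * M * (1 - s) ^ (-ν) := by
    intro x hx
    obtain ⟨h1, h2⟩ := cone z hz s hs x hx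
    have h3 := hBw _ h1
    have hxD := memD z hz s hs hx
    rw [add_sub_cancel] at h3
    have h4 : ((1 - s) / (1 + m)) ^ ν ≤ B * w x := by
      refine le_trans (Real.rpow_le_rpow (by positivity) ?_ hν.le) h3
      have h5 : (1 - s) / (1 + m) = 1 / (1 + m) + 1 / (1 + m) * -s := by ring
      have h6 : 1 / (1 + m) ≤ 1 := by
        rw [div_le_one (by positivity)]; linarith
      have h7 : 0 ≤ 1 / (1 + m) * η := by positivity
      have h8 : 1 / (1 + m) * (η - s) = 1 / (1 + m) * η + 1 / (1 + m) * -s := by ring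
      linarith
    have h5 : ((1 - s) / (1 + m)) ^ ν * ‖f x‖ ≤ B * M := by
      refine (mul_le_mul_of_nonneg_right h4 (norm_nonneg _)).trans ?_
      rw [mul_assoc]
      exact mul_le_mul_of_nonneg_left (hM x hxD) hB.le
    rw [Real.div_rpow hs1.le (by positivity)] at h5
    rw [Real.rpow_neg hs1.le]
    have hp1 : 0 < (1 - s) ^ ν := by positivity
    have hp2 : 0 < (1 + m) ^ ν := by positivity
    rw [← div_eq_mul_inv, le_div_iff₀ hp1]
    rw [div_mul_eq_mul_div, div_le_iff₀ hp2] at h5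
    linarith
  have hR : 0 < r * (η / 2 - s) := mul_pos hr0 (by linarith)
  have hp : 0 < (1 - s) ^ (-ν) := by positivity
  have hQ : 0 ≤ B * (1 + m) ^ ν * M * (1 - s) ^ (-ν) := by positivity
  have hε1 : 0 < 1 / ε := by positivity
  constructor
  · refine (bound _ (Metric.mem_closedBall_self hR.le)).trans ?_
    calc _ ≤ B * (1 + m) ^ ν * M * (1 - s) ^ (-ν) * (1 + 1 / ε) :=
          le_mul_of_one_le_right hQ (by linarith)
      _ = _ := by ring
  · have h1 := norm_deriv_le_of_closedBall hf hR (memD z hz s hs) bound 1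
    simp only [iteratedDeriv_one, Nat.factorial_one, Nat.cast_one, one_mul, pow_one] at h1
    have h2 : ε * (1 - s) ≤ r * (η / 2 - s) := by
      have : r * (η / 2 * (1 - s)) ≤ r * (η / 2 - s) :=
        mul_le_mul_of_nonneg_left (by nlinarith) hr0.le
      calc _ = r * (η / 2 * (1 - s)) := by rw [hεdef]; ring
        _ ≤ _ := this
    refine h1.trans ((div_le_div_of_nonneg_left hQ (by positivity) h2).trans ?_)
    rw [Real.rpow_sub_one hs1.ne']
    calc _ = B * (1 + m) ^ ν * M * (1 - s) ^ (-ν) / (1 - s) * (1 / ε) := by field_simp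
      _ ≤ B * (1 + m) ^ ν * M * (1 - s) ^ (-ν) / (1 - s) * (1 + 1 / ε) :=
          mul_le_mul_of_nonneg_left (by linarith) (by positivity)
      _ = _ := by ring

end IsConeWeight

/-! ### Oscillatory integrals -/

/-- The factor `e^{iλs}`. -/
noncomputable def osc (lam s : ℝ) : ℂ := Complex.exp ((lam * s : ℝ) * Complex.I)

lemma norm_osc (lam s : ℝ) : ‖osc lam s‖ = 1 := Complex.norm_exp_ofReal_mul_I _

lemma continuous_osc (lam : ℝ) : Continuous (osc lam) := by unfold osc; fun_prop

lemma hasDerivAt_osc (lam s : ℝ) : HasDerivAt (osc lam) (lam * Complex.I * osc lam s) s := by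
  have h1 : HasDerivAt (fun s : ℝ => ((lam * s : ℝ) : ℂ) * Complex.I) (lam * Complex.I) s := by
    have := ((hasDerivAt_id s).const_mul lam).ofReal_comp.mul_const Complex.I
    simpa using this
  have := h1.cexp
  rw [mul_comm] at this
  exact this

lemma hasDerivAt_comp_add_ofReal {f : ℂ → ℂ} {v : ℂ} {s : ℝ}
    (hf : DifferentiableAt ℂ f (v + s)) :
    HasDerivAt (fun s : ℝ => f (v + s)) (deriv f (v + s)) s := by
  have h2 : HasDerivAt (fun s : ℝ => v + (s : ℂ)) 1 s := by
    simpa using (hasDerivAt_id s).ofReal_comp.const_add v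
  have := HasDerivAt.comp s hf.hasDerivAt h2
  rw [mul_one] at this
  exact this

lemma hasDerivAt_mul_osc {f : ℂ → ℂ} {v : ℂ} {s : ℝ} (lam : ℝ)
    (hf : DifferentiableAt ℂ f (v + s)) :
    HasDerivAt (fun s : ℝ => f (v + s) * osc lam s)
      (deriv f (v + s) * osc lam s + lam * Complex.I * (f (v + s) * osc lam s)) s := by
  have := (hasDerivAt_comp_add_ofReal hf).mul (hasDerivAt_osc lam s)
  refine this.congr_deriv ?_
  ring

lemma integrableOn_mul_osc {g : ℝ → ℂ} {S : Set ℝ} (lam : ℝ) (hg : IntegrableOn g S) :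
    IntegrableOn (fun s => g s * osc lam s) S :=
  hg.mul_bdd (c := 1) (continuous_osc lam).aestronglyMeasurable
    (.of_forall fun s => (norm_osc lam s).le)

/-- Integration by parts against `e^{iλs}`. -/
lemma integral_deriv_mul_osc {D : Set ℂ} (hD : IsOpen D) {f : ℂ → ℂ}
    (hf : DifferentiableOn ℂ f D) {v : ℂ} {a lam : ℝ} (hv : ∀ s : ℝ, s ≤ a → v + s ∈ D)
    (hf_int : lam = 0 ∨ IntegrableOn (fun s : ℝ => f (v + s)) (Set.Iic a))
    (hf'_int : IntegrableOn (fun s : ℝ => deriv f (v + s)) (Set.Iic a))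
    (hlim : Filter.Tendsto (fun s : ℝ => f (v + s)) Filter.atBot (nhds 0)) :
    ∫ s in Set.Iic a, deriv f (v + s) * osc lam s
      = f (v + a) * osc lam a
        - lam * Complex.I * ∫ s in Set.Iic a, f (v + s) * osc lam s := by
  have i1 := integrableOn_mul_osc lam hf'_int
  have i2 : IntegrableOn (fun s : ℝ => lam * Complex.I * (f (v + s) * osc lam s))
      (Set.Iic a) := by
    rcases hf_int with h | h
    · simp [h]
    · exact (integrableOn_mul_osc lam h).const_mul _
  have hlim' : Filter.Tendsto (fun s : ℝ => f (v + s) * osc lam s) Filter.atBot (nhds 0) := by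
    rw [tendsto_zero_iff_norm_tendsto_zero] at hlim ⊢
    simpa [norm_osc] using hlim
  have := integral_Iic_of_hasDerivAt_of_tendsto'
    (fun s hs => hasDerivAt_mul_osc lam ((hf _ (hv s hs)).differentiableAt
      (hD.mem_nhds (hv s hs)))) (i1.add i2) hlim'
  rw [integral_add i1 i2, integral_const_mul] at this
  linear_combination this

/-- A holomorphic function bounded by `A` on the cone below `v` has an oscillatory integral
`∫ f'(v + s) e^{iλs} ds` bounded by a multiple of `A` that does not depend on `λ`. -/
lemma norm_integral_deriv_mul_osc_le {D : Set ℂ} (hD : IsOpen D) {f : ℂ → ℂ}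
    (hf : DifferentiableOn ℂ f D) {v : ℂ} {m A : ℝ} (hm : 0 < m)
    (hv : ∀ s ∈ leftCone m, v + s ∈ D) (hA : ∀ s ∈ leftCone m, ‖f (v + s)‖ ≤ A)
    (hf'_int : IntegrableOn (fun s : ℝ => deriv f (v + s)) (Set.Iic 0))
    (hlim : Filter.Tendsto (fun s : ℝ => f (v + s)) Filter.atBot (nhds 0)) (lam : ℝ) :
    ‖∫ s in Set.Iic (0 : ℝ), deriv f (v + s) * osc lam s‖
      ≤ (3 + (1 + m) / m + 2 * ((1 + m) / m) ^ 2) * A := by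
  have hv' : ∀ s : ℝ, s ≤ 0 → v + s ∈ D := fun s hs => hv _ (ofReal_mem_leftCone hm hs)
  have hA' : ∀ s : ℝ, s ≤ 0 → ‖f (v + s)‖ ≤ A := fun s hs => hA _ (ofReal_mem_leftCone hm hs)
  have hA0 : 0 ≤ A := (norm_nonneg _).trans (hA' 0 le_rfl)
  set q := (1 + m) / m with hq
  have hq0 : 0 < q := by positivity
  rcases eq_or_ne lam 0 with rfl | hlam
  · rw [integral_deriv_mul_osc hD hf hv' (.inl rfl) hf'_int hlim]
    simp only [Complex.ofReal_zero, zero_mul, sub_zero]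
    rw [norm_mul, norm_osc, mul_one]
    have := hA' 0 le_rfl
    have : 0 ≤ (q + 2 * q ^ 2) * A := by positivity
    rw [Complex.ofReal_zero] at *
    linarith
  set a := 1 / |lam| with ha
  have hl0 : 0 < |lam| := abs_pos.2 hlam
  have ha0 : 0 < a := by positivity
  have hdiff : ∀ s : ℝ, s ≤ 0 → DifferentiableAt ℂ f (v + s) := fun s hs =>
    (hf _ (hv' s hs)).differentiableAt (hD.mem_nhds (hv' s hs))
  have hf' : DifferentiableOn ℂ (deriv f) D := hf.deriv hD
  have cauchy : ∀ s : ℝ, s < 0 → ∀ n : ℕ,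
      ‖iteratedDeriv n f (v + s)‖ ≤ n.factorial * A * q ^ n * ((-s) ^ n)⁻¹ := by
    intro s hs n
    have hR : 0 < m / (1 + m) * -s := mul_pos (by positivity) (by linarith)
    have hx : ∀ x ∈ Metric.closedBall (v + s) (m / (1 + m) * -s), x - v ∈ leftCone m := by
      intro x hx
      rw [mem_closedBall_iff_norm] at hx
      refine (mem_leftCone_of_norm_sub_le hm (t := -s) ?_).1
      rwa [Complex.ofReal_neg, ← sub_eq_add_neg, sub_sub]
    have h := norm_deriv_le_of_closedBall hf hR
      (fun x h => by simpa using hv _ (hx x h)) (fun x h => by simpa using hA _ (hx x h)) n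
    refine h.trans_eq ?_
    rw [mul_pow, div_pow, hq, div_pow]
    field_simp
  have c1 : ∀ s : ℝ, s < 0 → ‖deriv f (v + s)‖ ≤ A * q * (-s)⁻¹ := fun s hs => by
    simpa using cauchy s hs 1
  have c2 : ∀ s : ℝ, s < 0 → ‖deriv (deriv f) (v + s)‖ ≤ 2 * A * q ^ 2 * ((-s) ^ 2)⁻¹ :=
    fun s hs => by
      have := cauchy s hs 2
      rwa [iteratedDeriv_succ, iteratedDeriv_one, Nat.factorial_two, Nat.cast_ofNat] at this
  have hsub : Set.Iic (-a) ⊆ Set.Iic (0 : ℝ) := Set.Iic_subset_Iic.2 (by linarith)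
  have cont1 : ∀ g : ℂ → ℂ, ContinuousOn g D → ContinuousOn (fun s : ℝ => g (v + s))
      (Set.Iic 0) := fun g hg =>
    hg.comp (by fun_prop) (fun s hs => hv' s hs)
  have near : ‖∫ s in (-a)..0, deriv f (v + s) * osc lam s‖ ≤ 3 * A := by
    have huIcc : Set.uIcc (-a) 0 ⊆ Set.Iic 0 := by
      rw [Set.uIcc_of_le (by linarith)]; exact Set.Icc_subset_Iic_self
    have i1 : IntervalIntegrable (fun s : ℝ => deriv f (v + s) * osc lam s) volume (-a) 0 :=
      (((cont1 _ hf'.continuousOn).mono huIcc).mul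
        (continuous_osc lam).continuousOn).intervalIntegrable
    have i2 : IntervalIntegrable (fun s : ℝ => lam * Complex.I * (f (v + s) * osc lam s))
        volume (-a) 0 :=
      ((((cont1 _ hf.continuousOn).mono huIcc).mul
        (continuous_osc lam).continuousOn).intervalIntegrable).const_mul _
    have h := intervalIntegral.integral_eq_sub_of_hasDerivAt
      (fun s hs => hasDerivAt_mul_osc lam (hdiff s (huIcc hs))) (i1.add i2)
    rw [intervalIntegral.integral_add i1 i2, intervalIntegral.integral_const_mul] at h
    rw [eq_sub_of_add_eq h]
    have b1 : ‖∫ s in (-a)..0, f (v + s) * osc lam s‖ ≤ A * |0 - -a| := by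
      refine intervalIntegral.norm_integral_le_of_norm_le_const fun s hs => ?_
      rw [Set.uIoc_of_le (by linarith)] at hs
      rw [norm_mul, norm_osc, mul_one]
      exact hA' s hs.2
    have b2 : ‖(lam : ℂ) * Complex.I * ∫ s in (-a)..0, f (v + s) * osc lam s‖ ≤ A := by
      rw [norm_mul, norm_mul, Complex.norm_I, mul_one, Complex.norm_real, Real.norm_eq_abs]
      calc _ ≤ |lam| * (A * |0 - -a|) := mul_le_mul_of_nonneg_left b1 hl0.le
        _ = A := by
          rw [zero_sub, neg_neg, abs_of_pos ha0, ha]; field_simp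
    have b3 : ∀ s : ℝ, s ≤ 0 → ‖f (v + s) * osc lam s‖ ≤ A := fun s hs => by
      rw [norm_mul, norm_osc, mul_one]; exact hA' s hs
    refine (norm_sub_le _ _).trans ?_
    refine (add_le_add (norm_sub_le _ _) b2).trans ?_
    linarith [b3 0 le_rfl, b3 (-a) (by linarith)]
  have far : ‖∫ s in Set.Iic (-a), deriv f (v + s) * osc lam s‖ ≤ (q + 2 * q ^ 2) * A := by
    have hpow : IntegrableOn (fun s : ℝ => ((-s) ^ 2)⁻¹) (Set.Iic (-a)) ∧
        ∫ s in Set.Iic (-a), ((-s) ^ 2)⁻¹ = a⁻¹ := by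
      have e : ∀ s : ℝ, (s ^ 2)⁻¹ = s ^ (-2 : ℝ) := fun s => by
        rw [show (-2 : ℝ) = ((-2 : ℤ) : ℝ) by norm_num, Real.rpow_intCast]; rfl
      constructor
      · have h := (integrable_indicator_iff measurableSet_Ioi).2
          (integrableOn_Ioi_rpow_of_lt (a := -2) (by norm_num) (half_pos ha0))
        have h2 := h.comp_neg.integrableOn (s := Set.Iic (-a))
        refine h2.congr_fun (fun s hs => ?_) measurableSet_Iic
        have hs' : s ≤ -a := hs
        simp only [Set.indicator, e]
        rw [if_pos]
        simp only [Set.mem_Ioi]; linarith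
      · rw [integral_comp_neg_Iic (-a) (fun s => (s ^ 2)⁻¹), neg_neg]
        simp_rw [e]
        rw [integral_Ioi_rpow_of_lt (by norm_num) ha0]
        norm_num
        rw [Real.rpow_neg_one]
    have i2 : IntegrableOn (fun s : ℝ => deriv (deriv f) (v + s)) (Set.Iic (-a)) := by
      refine (hpow.1.const_mul (2 * A * q ^ 2)).mono'
        (((cont1 _ (hf'.deriv hD).continuousOn).mono hsub).aestronglyMeasurable
          measurableSet_Iic) ?_
      filter_upwards [ae_restrict_mem measurableSet_Iic] with s hs
      have hs' : s ≤ -a := hs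
      exact c2 s (by linarith)
    have hlim1 : Filter.Tendsto (fun s : ℝ => deriv f (v + s)) Filter.atBot (nhds 0) := by
      refine squeeze_zero_norm' (a := fun s : ℝ => A * q * (-s)⁻¹) ?_ ?_
      · filter_upwards [Filter.eventually_lt_atBot (0 : ℝ)] with s hs using c1 s hs
      · simpa using (Filter.tendsto_neg_atBot_atTop.inv_tendsto_atTop.const_mul (A * q))
    have h := integral_deriv_mul_osc hD hf' (lam := lam) (v := v) (a := -a)
      (fun s hs => hv' s (by linarith)) (.inr (hf'_int.mono_set hsub)) i2 hlim1
    have b1 : ‖∫ s in Set.Iic (-a), deriv (deriv f) (v + s) * osc lam s‖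
        ≤ 2 * A * q ^ 2 * a⁻¹ := by
      rw [← hpow.2, ← integral_const_mul]
      refine norm_integral_le_of_norm_le (hpow.1.const_mul _) ?_
      filter_upwards [ae_restrict_mem measurableSet_Iic] with s hs
      have hs' : s ≤ -a := hs
      rw [norm_mul, norm_osc, mul_one]
      exact c2 s (by linarith)
    have b2 : ‖deriv f (v + (-a : ℝ)) * osc lam (-a)‖ ≤ A * q * a⁻¹ := by
      rw [norm_mul, norm_osc, mul_one]
      simpa using c1 (-a) (by linarith)
    have h' : lam * Complex.I * ∫ s in Set.Iic (-a), deriv f (v + s) * osc lam s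
        = deriv f (v + (-a : ℝ)) * osc lam (-a)
          - ∫ s in Set.Iic (-a), deriv (deriv f) (v + s) * osc lam s := by
      linear_combination h
    have h2 := congrArg norm h'
    rw [norm_mul, norm_mul, Complex.norm_I, mul_one, Complex.norm_real, Real.norm_eq_abs] at h2
    have h3 := (h2.trans_le (norm_sub_le _ _)).trans (add_le_add b2 b1)
    have hainv : a⁻¹ = |lam| := by rw [ha, one_div, inv_inv]
    rw [hainv] at h3
    refine le_of_mul_le_mul_left ?_ hl0
    linarith
  have hint := integrableOn_mul_osc lam hf'_int
  have hsplit : ∫ s in Set.Iic (0 : ℝ), deriv f (v + s) * osc lam s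
      = (∫ s in Set.Iic (-a), deriv f (v + s) * osc lam s)
        + ∫ s in (-a)..0, deriv f (v + s) * osc lam s := by
    rw [← intervalIntegral.integral_Iic_sub_Iic (hint.mono_set hsub) hint]
    ring
  rw [hsplit]
  refine (norm_add_le _ _).trans ?_
  linarith

/-! ### Differentiation under the integral sign and Fourier series -/

lemma hasDerivAt_integral_of_norm_deriv_le {X : Type*} [MeasurableSpace X] {μ : Measure X}
    {F : ℂ → X → ℂ} {v : ℂ} {ε : ℝ} (hε : 0 < ε) {b : X → ℝ}
    (hF_meas : ∀ z ∈ Metric.ball v ε, AEStronglyMeasurable (F z) μ)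
    (hF_int : Integrable (F v) μ)
    (hF_diff : ∀ᵐ x ∂μ, DifferentiableOn ℂ (fun z => F z x) (Metric.ball v ε))
    (hF_bound : ∀ᵐ x ∂μ, ∀ z ∈ Metric.ball v ε, ‖deriv (fun z => F z x) z‖ ≤ b x)
    (hb : Integrable b μ) :
    HasDerivAt (fun z => ∫ x, F z x ∂μ) (∫ x, deriv (fun z => F z x) v ∂μ) v := by
  have hball : Metric.ball v ε ∈ nhds v := Metric.ball_mem_nhds v hε
  refine (hasDerivAt_integral_of_dominated_loc_of_deriv_le hball
    (Filter.eventually_of_mem hball hF_meas) hF_int (F' := fun z x => deriv (fun z => F z x) z)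
    ?_ hF_bound hb ?_).2
  · set u : ℕ → ℂ := fun n => v + ((ε / (n + 2) : ℝ) : ℂ) with hu
    have hpos : ∀ n : ℕ, 0 < ε / ((n : ℝ) + 2) := fun n => by positivity
    have humem : ∀ n, u n ∈ Metric.ball v ε := fun n => by
      rw [mem_ball_iff_norm, hu, add_sub_cancel_left, Complex.norm_real,
        Real.norm_of_nonneg (hpos n).le, div_lt_iff₀ (by positivity)]
      have : (0 : ℝ) ≤ n := Nat.cast_nonneg n
      nlinarith
    have hut : Filter.Tendsto u Filter.atTop (nhdsWithin v {v}ᶜ) := by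
      refine tendsto_nhdsWithin_of_tendsto_nhds_of_eventually_within _ ?_
        (.of_forall fun n => ?_)
      · have h1 : Filter.Tendsto (fun n : ℕ => ε / ((n : ℝ) + 2)) Filter.atTop (nhds 0) :=
          Filter.Tendsto.div_atTop tendsto_const_nhds
            (Filter.tendsto_atTop_add_const_right _ _ tendsto_natCast_atTop_atTop)
        have h2 := (Complex.continuous_ofReal.tendsto 0).comp h1
        have h3 := h2.const_add v
        rw [Complex.ofReal_zero, add_zero] at h3
        exact h3
      · simp only [hu, Set.mem_compl_iff, Set.mem_singleton_iff, add_eq_left]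
        exact Complex.ofReal_ne_zero.2 (hpos n).ne'
    refine aestronglyMeasurable_of_tendsto_ae (u := Filter.atTop)
      (f := fun n x => slope (fun z => F z x) v (u n)) (fun n => ?_) ?_
    · simp only [slope, vsub_eq_sub, smul_eq_mul]
      exact ((hF_meas _ (humem n)).sub hF_int.aestronglyMeasurable).const_mul _
    · filter_upwards [hF_diff] with x hx
      exact (hx.differentiableAt hball).hasDerivAt.tendsto_slope.comp hut
  · filter_upwards [hF_diff] with x hx z hz
    exact (hx.differentiableAt (Metric.isOpen_ball.mem_nhds hz)).hasDerivAt

lemma osc_add (a b s : ℝ) : osc (a + b) s = osc a s * osc b s := by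
  rw [osc, osc, osc, ← Complex.exp_add]; push_cast; ring_nf

lemma osc_add_right (a s r : ℝ) : osc a (s + r) = osc a s * osc a r := by
  rw [osc, osc, osc, ← Complex.exp_add]; push_cast; ring_nf

lemma osc_mul_right (a b s : ℝ) : osc a (b * s) = osc (a * b) s := by
  rw [osc, osc, mul_assoc]

lemma osc_zero (s : ℝ) : osc 0 s = 1 := by simp [osc]

lemma fourierCoefC_eq_integral_osc (h : ℂ → ℝ → ℂ) (l : ℤ) (v : ℂ) :
    fourierCoefC h l v = (1 / (2 * Real.pi) : ℂ) *
      ∫ ξ in (0 : ℝ)..(2 * Real.pi), h v ξ * osc (-l) ξ := by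
  unfold fourierCoefC osc
  congr 2
  funext ξ
  push_cast
  ring_nf

lemma integral_osc_int (n : ℤ) :
    ∫ ξ in (0 : ℝ)..(2 * Real.pi), osc n ξ = if n = 0 then (2 * Real.pi : ℂ) else 0 := by
  split_ifs with h
  · simp [h, osc_zero]
  · have hc : (n : ℂ) * Complex.I ≠ 0 := mul_ne_zero (Int.cast_ne_zero.2 h) Complex.I_ne_zero
    have e : ∀ ξ : ℝ, osc n ξ = Complex.exp ((n : ℂ) * Complex.I * ξ) := fun ξ => by
      unfold osc; push_cast; ring_nf
    simp_rw [e]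
    rw [integral_exp_mul_complex hc]
    have : Complex.exp ((n : ℂ) * Complex.I * ((2 * Real.pi : ℝ) : ℂ)) = 1 := by
      rw [Complex.exp_eq_one_iff]
      exact ⟨n, by push_cast; ring⟩
    rw [this]
    simp

lemma fourierCoefC_eq_of_hasSum {h : ℂ → ℝ → ℂ} {v : ℂ} {a : ℤ → ℂ}
    (ha : Summable fun l => ‖a l‖) (hsum : ∀ ξ, HasSum (fun l : ℤ => a l * osc l ξ) (h v ξ))
    (l : ℤ) : fourierCoefC h l v = a l := by
  have key : HasSum (fun k : ℤ => ∫ ξ in (0 : ℝ)..(2 * Real.pi), a k * osc k ξ * osc (-l) ξ)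
      (∫ ξ in (0 : ℝ)..(2 * Real.pi), h v ξ * osc (-l) ξ) := by
    refine intervalIntegral.hasSum_integral_of_dominated_convergence (fun k _ => ‖a k‖)
      (fun k => ?_) (fun k => .of_forall fun ξ _ => ?_) (.of_forall fun _ _ => ha)
      intervalIntegrable_const (.of_forall fun ξ _ => (hsum ξ).mul_right _)
    · exact ((continuous_const.mul (continuous_osc _)).mul
        (continuous_osc _)).aestronglyMeasurable
    · rw [norm_mul, norm_mul, norm_osc, norm_osc, mul_one, mul_one]
  have e : ∀ k : ℤ, ∫ ξ in (0 : ℝ)..(2 * Real.pi), a k * osc k ξ * osc (-l) ξ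
      = if k = l then a l * (2 * Real.pi) else 0 := fun k => by
    have e1 : ∀ ξ : ℝ, a k * osc k ξ * osc (-l) ξ = a k * osc ((k - l : ℤ) : ℝ) ξ := fun ξ => by
      rw [mul_assoc, ← osc_add, Int.cast_sub, sub_eq_add_neg]
    simp_rw [e1]
    rw [intervalIntegral.integral_const_mul, integral_osc_int]
    by_cases hkl : k = l
    · simp [hkl]
    · simp [hkl, sub_eq_zero]
  simp_rw [e] at key
  have := key.unique (hasSum_ite_eq l (a l * (2 * Real.pi)))
  rw [fourierCoefC_eq_integral_osc, this]
  have : (Real.pi : ℂ) ≠ 0 := Complex.ofReal_ne_zero.2 Real.pi_ne_zero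
  field_simp

lemma hasSum_fourierCoefC {h : ℂ → ℝ → ℂ} {v : ℂ} (hcont : Continuous (h v))
    (hper : ∀ ξ, h v (ξ + 2 * Real.pi) = h v ξ)
    (hsum : Summable fun l => ‖fourierCoefC h l v‖) (ξ : ℝ) :
    HasSum (fun l : ℤ => fourierCoefC h l v * osc l ξ) (h v ξ) := by
  have : Fact (0 < 2 * Real.pi) := ⟨Real.two_pi_pos⟩
  have hp : Function.Periodic (h v) (2 * Real.pi) := hper
  set f : C(AddCircle (2 * Real.pi), ℂ) := ⟨hp.lift, by
    exact continuous_coinduced_dom.2 hcont⟩ with hf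
  have hfx : ∀ x : ℝ, f (x : AddCircle (2 * Real.pi)) = h v x := fun x => rfl
  have hosc : ∀ (n : ℤ) (x : ℝ), fourier n (x : AddCircle (2 * Real.pi)) = osc n x := by
    intro n x
    rw [fourier_coe_apply, osc]
    congr 1
    have : (Real.pi : ℂ) ≠ 0 := Complex.ofReal_ne_zero.2 Real.pi_ne_zero
    push_cast
    field_simp
  have hcoef : ∀ l, fourierCoeff f l = fourierCoefC h l v := by
    intro l
    rw [fourierCoeff_eq_intervalIntegral f l 0, fourierCoefC_eq_integral_osc, zero_add]
    rw [Complex.real_smul]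
    congr 1
    · push_cast; rfl
    · congr 1
      funext x
      rw [hosc, hfx, smul_eq_mul, mul_comm, Int.cast_neg]
  have := has_pointwise_sum_fourier_series_of_summable (f := f)
    (by simp_rw [funext hcoef]; exact hsum.of_norm) (ξ : AddCircle (2 * Real.pi))
  simpa only [hcoef, hosc, hfx, smul_eq_mul] using this

lemma norm_le_mul_of_one_le_mul {x : ℂ} {w g A : ℝ} (hw : 0 < w) (hg : 1 ≤ g * w)
    (hA : w * ‖x‖ ≤ A) : ‖x‖ ≤ A * g := by
  have h0 : 0 ≤ w * ‖x‖ := by positivity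
  have hg0 : 0 < g := pos_of_mul_pos_left (one_pos.trans_le hg) hw.le
  nlinarith [norm_nonneg x]

/-! ### The operator `Gop` on functions with summable weighted Fourier coefficients -/

/-- `h` is holomorphic in `v ∈ D`, continuous and periodic in `ξ`, and its Fourier coefficients
are bounded by the summable family `M` with respect to the weight `w`. -/
structure HasFourierBound (D : Set ℂ) (w : ℂ → ℝ) (h : ℂ → ℝ → ℂ) (M : ℤ → ℝ) : Prop where
  differentiableOn : ∀ ξ : ℝ, DifferentiableOn ℂ (fun v => h v ξ) D
  continuous : ∀ v ∈ D, Continuous (h v)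
  periodic : ∀ v ∈ D, ∀ ξ : ℝ, h v (ξ + 2 * Real.pi) = h v ξ
  summable : Summable M
  le : ∀ l, ∀ v ∈ D, w v * ‖fourierCoefC h l v‖ ≤ M l

namespace HasFourierBound

variable {D : Set ℂ} {m ν C : ℝ} {w : ℂ → ℝ} {h : ℂ → ℝ → ℂ} {M : ℤ → ℝ}

lemma norm_coef_le (hh : HasFourierBound D w h M) (hw : IsConeWeight D m ν C w) {v : ℂ}
    (hv : v ∈ D) (l : ℤ) : ‖fourierCoefC h l v‖ ≤ M l / w v := by
  rw [le_div_iff₀ (hw.pos v hv), mul_comm]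
  exact hh.le l v hv

lemma summable_coef (hh : HasFourierBound D w h M) (hw : IsConeWeight D m ν C w) {v : ℂ}
    (hv : v ∈ D) : Summable fun l => ‖fourierCoefC h l v‖ :=
  (hh.summable.div_const (w v)).of_nonneg_of_le (fun _ => norm_nonneg _)
    (hh.norm_coef_le hw hv)

lemma hasSum (hh : HasFourierBound D w h M) (hw : IsConeWeight D m ν C w) {v : ℂ}
    (hv : v ∈ D) (ξ : ℝ) : HasSum (fun l : ℤ => fourierCoefC h l v * osc l ξ) (h v ξ) :=
  hasSum_fourierCoefC (hh.continuous v hv) (hh.periodic v hv) (hh.summable_coef hw hv) ξ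

lemma weight_mul_norm_le (hh : HasFourierBound D w h M) (hw : IsConeWeight D m ν C w)
    (ξ : ℝ) : ∀ v ∈ D, w v * ‖h v ξ‖ ≤ ∑' l, M l := by
  intro v hv
  have h1 : ‖h v ξ‖ ≤ ∑' l, M l / w v := by
    rw [← (hh.hasSum hw hv ξ).tsum_eq]
    refine tsum_of_norm_bounded (hh.summable.div_const (w v)).hasSum fun l => ?_
    rw [norm_mul, norm_osc, mul_one]
    exact hh.norm_coef_le hw hv l
  rw [tsum_div_const, le_div_iff₀ (hw.pos v hv)] at h1
  rwa [mul_comm]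

lemma differentiableOn_coef (hh : HasFourierBound D w h M) (hw : IsConeWeight D m ν C w)
    (l : ℤ) : DifferentiableOn ℂ (fourierCoefC h l) D := by
  intro v hv
  obtain ⟨ε, hε, B, hB, hball, hbd⟩ := hw.exists_local_bounds hv
  have hcont : ∀ z ∈ D, Continuous fun ξ => h z ξ * osc (-l) ξ := fun z hz =>
    (hh.continuous z hz).mul (continuous_osc _)
  have hd : ∀ ξ, DifferentiableOn ℂ (fun z => h z ξ * osc (-l) ξ) (Metric.ball v ε) := fun ξ =>
    ((hh.differentiableOn ξ).mono hball).mul_const _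
  have := hasDerivAt_integral_of_norm_deriv_le (v := v) hε
    (μ := volume.restrict (Set.Ioc 0 (2 * Real.pi))) (F := fun z ξ => h z ξ * osc (-l) ξ)
    (b := fun _ => B * ∑' l, M l) (fun z hz => (hcont z (hball hz)).aestronglyMeasurable)
    ((hcont v hv).integrableOn_Ioc) (.of_forall hd) (.of_forall fun ξ z hz => ?_)
    (integrable_const _)
  · refine DifferentiableAt.differentiableWithinAt ?_
    have e : fourierCoefC h l = fun z => (1 / (2 * Real.pi) : ℂ) *
        ∫ ξ in Set.Ioc 0 (2 * Real.pi), h z ξ * osc (-l) ξ := by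
      funext z
      rw [fourierCoefC_eq_integral_osc, intervalIntegral.integral_of_le Real.two_pi_pos.le]
    rw [e]
    exact this.differentiableAt.const_mul _
  · rw [deriv_mul_const (((hh.differentiableOn ξ).mono hball).differentiableAt
      (Metric.isOpen_ball.mem_nhds hz)), norm_mul, norm_osc, mul_one]
    have := (hbd _ _ (hh.differentiableOn ξ) (hh.weight_mul_norm_le hw ξ) z hz 0 le_rfl).2
    simpa using this

lemma hasSum_deriv (hh : HasFourierBound D w h M) (hw : IsConeWeight D m ν C w) {v : ℂ}
    (hv : v ∈ D) (ξ : ℝ) :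
    HasSum (fun l : ℤ => deriv (fourierCoefC h l) v * osc l ξ) (deriv (fun z => h z ξ) v) := by
  obtain ⟨ε, hε, B, hB, hball, hbd⟩ := hw.exists_local_bounds hv
  have hdiff := fun l => hh.differentiableOn_coef hw l
  have hb : ∀ l : ℤ, ∀ z ∈ Metric.ball v ε, ‖fourierCoefC h l z * osc l ξ‖ ≤ B * M l := by
    intro l z hz
    rw [norm_mul, norm_osc, mul_one]
    simpa using (hbd _ _ (hdiff l) (hh.le l) z hz 0 le_rfl).1
  have := Complex.hasSum_deriv_of_summable_norm (hh.summable.mul_left B)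
    (fun l => ((hdiff l).mono hball).mul_const (osc l ξ)) Metric.isOpen_ball hb
    (Metric.mem_ball_self hε)
  have e : (fun z => ∑' l : ℤ, fourierCoefC h l z * osc l ξ) =ᶠ[nhds v] fun z => h z ξ :=
    Filter.eventually_of_mem (Metric.ball_mem_nhds v hε) fun z hz =>
      (hh.hasSum hw (hball hz) ξ).tsum_eq
  rw [e.deriv_eq] at this
  refine this.congr_fun fun l => ?_
  rw [deriv_mul_const ((hdiff l).differentiableAt (hw.isOpen.mem_nhds hv))]

lemma continuousOn_flow (hh : HasFourierBound D w h M) (hw : IsConeWeight D m ν C w) {v : ℂ}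
    (hv : v ∈ D) (γ ξ : ℝ) :
    ContinuousOn (fun s : ℝ => h (v + s) (ξ + γ * s)) (Set.Iic 0) := by
  obtain ⟨ε, hε, B, hB, hball, hbd⟩ := hw.exists_local_bounds hv
  have hmem : ∀ s ∈ Set.Iic (0 : ℝ), v + (s : ℂ) ∈ D := fun s hs => hw.add_ofReal_mem hv hs
  have : ContinuousOn (fun s : ℝ => ∑' l : ℤ, fourierCoefC h l (v + s) * osc l (ξ + γ * s))
      (Set.Iic 0) := by
    refine continuousOn_tsum (fun l => ?_) (hh.summable.mul_left B) fun l s hs => ?_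
    · refine ContinuousOn.mul ?_ ?_
      · exact (hh.differentiableOn_coef hw l).continuousOn.comp (by fun_prop) hmem
      · exact ((continuous_osc l).comp (by fun_prop)).continuousOn
    · have hs' : s ≤ 0 := hs
      rw [norm_mul, norm_osc, mul_one]
      refine (hbd _ _ (hh.differentiableOn_coef hw l) (hh.le l) v
        (Metric.mem_ball_self hε) s hs).1.trans ?_
      refine mul_le_of_le_one_right ?_
        (Real.rpow_le_one_of_one_le_of_nonpos (by linarith) (by linarith [hw.exponent_pos]))
      exact mul_nonneg hB.le (le_trans (mul_nonneg (hw.pos v hv).le (norm_nonneg _)) (hh.le l v hv))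
  refine this.congr fun s hs => ?_
  exact (hh.hasSum hw (hmem s hs) _).tsum_eq.symm

lemma nonneg (hh : HasFourierBound D w h M) (hw : IsConeWeight D m ν C w) {v : ℂ}
    (hv : v ∈ D) (l : ℤ) : 0 ≤ M l :=
  le_trans (mul_nonneg (hw.pos v hv).le (norm_nonneg _)) (hh.le l v hv)

/-- Differentiation of `Gop` in `v` under the integral sign. -/
lemma hasDerivAt_Gop (hh : HasFourierBound D w h M) (hw : IsConeWeight D m ν C w) {v : ℂ}
    (hv : v ∈ D) {G ξ : ℝ}
    (hint : IntegrableOn (fun s : ℝ => h (v + s) (ξ + G ^ 3 * s)) (Set.Iic 0)) :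
    HasDerivAt (fun z => Gop G h z ξ)
      (∫ s in Set.Iic (0 : ℝ), deriv (fun z => h z (ξ + G ^ 3 * s)) (v + s)) v := by
  obtain ⟨ε, hε, B, hB, hball, hbd⟩ := hw.exists_local_bounds hv
  have hsub : ∀ s : ℝ, s ≤ 0 → ∀ z ∈ Metric.ball v ε, z + s ∈ D := fun s hs z hz =>
    hw.add_ofReal_mem (hball hz) hs
  have := hasDerivAt_integral_of_norm_deriv_le (v := v) hε
    (μ := volume.restrict (Set.Iic 0)) (F := fun z s => h (z + (s : ℝ)) (ξ + G ^ 3 * s))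
    (b := fun s => B * (∑' l, M l) * (1 - s) ^ (-(ν + 1)))
    (fun z hz => (hh.continuousOn_flow hw (hball hz) (G ^ 3) ξ).aestronglyMeasurable
      measurableSet_Iic) hint ?_ ?_ ?_
  · refine this.congr_deriv (integral_congr_ae (.of_forall fun s => ?_))
    exact deriv_comp_add_const (f := fun z => h z (ξ + G ^ 3 * s)) _ _
  · filter_upwards [ae_restrict_mem measurableSet_Iic] with s hs
    exact (hh.differentiableOn _).comp (by fun_prop) (hsub s hs)
  · filter_upwards [ae_restrict_mem measurableSet_Iic] with s hs z hz
    rw [deriv_comp_add_const (f := fun z => h z (ξ + G ^ 3 * s))]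
    rw [neg_add']
    exact (hbd _ _ (hh.differentiableOn _) (hh.weight_mul_norm_le hw _) z hz s hs).2
  · exact (integrableOn_rpow_sub one_pos (by linarith [hw.exponent_pos])).const_mul _

lemma integrableOn_deriv (hw : IsConeWeight D m ν C w) {f : ℂ → ℂ} {A : ℝ}
    (hf : DifferentiableOn ℂ f D) (hA : ∀ v ∈ D, w v * ‖f v‖ ≤ A) {v : ℂ} (hv : v ∈ D) :
    IntegrableOn (fun s : ℝ => deriv f (v + s)) (Set.Iic 0) := by
  obtain ⟨ε, hε, B, hB, hball, hbd⟩ := hw.exists_local_bounds hv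
  have hmem : ∀ s ∈ Set.Iic (0 : ℝ), v + (s : ℂ) ∈ D := fun s hs => hw.add_ofReal_mem hv hs
  refine ((integrableOn_rpow_sub one_pos (p := ν + 1) (by linarith [hw.exponent_pos])).const_mul
    (B * A)).mono' (((hf.deriv hw.isOpen).continuousOn.comp (by fun_prop)
      hmem).aestronglyMeasurable measurableSet_Iic) ?_
  filter_upwards [ae_restrict_mem measurableSet_Iic] with s hs
  rw [neg_add']
  exact (hbd _ _ hf hA v (Metric.mem_ball_self hε) s hs).2

lemma tendsto_zero (hw : IsConeWeight D m ν C w) {f : ℂ → ℂ} {A : ℝ}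
    (hf : DifferentiableOn ℂ f D) (hA : ∀ v ∈ D, w v * ‖f v‖ ≤ A) {v : ℂ} (hv : v ∈ D) :
    Filter.Tendsto (fun s : ℝ => f (v + s)) Filter.atBot (nhds 0) := by
  obtain ⟨ε, hε, B, hB, hball, hbd⟩ := hw.exists_local_bounds hv
  refine squeeze_zero_norm' (a := fun s : ℝ => B * A * (1 - s) ^ (-ν)) ?_ ?_
  · filter_upwards [Filter.eventually_le_atBot (0 : ℝ)] with s hs
    exact (hbd _ _ hf hA v (Metric.mem_ball_self hε) s hs).1
  · have h1 : Filter.Tendsto (fun s : ℝ => 1 - s) Filter.atBot Filter.atTop := by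
      simp_rw [sub_eq_add_neg]
      exact Filter.tendsto_atTop_add_const_left _ _ Filter.tendsto_neg_atBot_atTop
    have := ((tendsto_rpow_neg_atTop hw.exponent_pos).comp h1).const_mul (B * A)
    simpa using this

/-- The Fourier series of an integral of `Σ_l f_l(v + s) e^{il(ξ + γs)}` along the flow. -/
lemma hasSum_integral_flow {f : ℤ → ℝ → ℂ} {M : ℤ → ℝ} (hM : Summable M) {g : ℝ → ℝ}
    (hg : IntegrableOn g (Set.Iic 0))
    (hf : ∀ l, ContinuousOn (f l) (Set.Iic 0)) (hle : ∀ l, ∀ s ≤ 0, ‖f l s‖ ≤ M l * g s)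
    {γ ξ : ℝ} {F : ℝ → ℂ} (hF : ∀ s ≤ 0, HasSum (fun l : ℤ => f l s * osc l (ξ + γ * s)) (F s)) :
      HasSum (fun l : ℤ => (∫ s in Set.Iic (0 : ℝ), f l s * osc (l * γ) s) * osc l ξ)
      (∫ s in Set.Iic (0 : ℝ), F s) := by
  have hFl_cont : ∀ l : ℤ, ContinuousOn (fun s => f l s * osc l (ξ + γ * s)) (Set.Iic 0) :=
    fun l => (hf l).mul ((continuous_osc l).comp (by fun_prop)).continuousOn
  have hFl_le : ∀ l : ℤ, ∀ s ≤ 0, ‖f l s * osc l (ξ + γ * s)‖ ≤ M l * g s := fun l s hs => by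
    rw [norm_mul, norm_osc, mul_one]
    exact hle l s hs
  have hFl_int : ∀ l : ℤ, IntegrableOn (fun s => f l s * osc l (ξ + γ * s)) (Set.Iic 0) :=
    fun l => (hg.const_mul (M l)).mono' ((hFl_cont l).aestronglyMeasurable measurableSet_Iic) <| by
      filter_upwards [ae_restrict_mem measurableSet_Iic] with s hs using hFl_le l s hs
  have hsum : Summable fun l : ℤ => ∫ s in Set.Iic (0 : ℝ), ‖f l s * osc l (ξ + γ * s)‖ := by
    refine (hM.mul_right (∫ s in Set.Iic (0 : ℝ), g s)).of_nonneg_of_le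
      (fun l => integral_nonneg fun _ => norm_nonneg _) fun l => ?_
    rw [← integral_const_mul]
    exact setIntegral_mono_on (hFl_int l).norm (hg.const_mul _) measurableSet_Iic
      fun s hs => hFl_le l s hs
  have hF_ae : (fun s => ∑' l : ℤ, f l s * osc l (ξ + γ * s)) =ᵐ[volume.restrict (Set.Iic 0)]
      F := by
    filter_upwards [ae_restrict_mem measurableSet_Iic] with s hs using (hF s hs).tsum_eq
  have key := hasSum_integral_of_summable_integral_norm hFl_int hsum
  rw [integral_congr_ae hF_ae] at key
  refine key.congr_fun fun l => ?_
  rw [← integral_mul_const]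
  refine integral_congr_ae (.of_forall fun s => ?_)
  simp only
  rw [osc_add_right, osc_mul_right]
  ring

lemma hasSum_deriv_Gop (hh : HasFourierBound D w h M) (hw : IsConeWeight D m ν C w) {v : ℂ}
    (hv : v ∈ D) {G ξ : ℝ}
    (hint : IntegrableOn (fun s : ℝ => h (v + s) (ξ + G ^ 3 * s)) (Set.Iic 0)) :
    HasSum (fun l : ℤ => (∫ s in Set.Iic (0 : ℝ),
        deriv (fourierCoefC h l) (v + s) * osc (l * G ^ 3) s) * osc l ξ)
      (deriv (fun z => Gop G h z ξ) v) := by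
  obtain ⟨ε, hε, B, hB, hball, hbd⟩ := hw.exists_local_bounds hv
  have hmem : ∀ s ∈ Set.Iic (0 : ℝ), v + (s : ℂ) ∈ D := fun s hs => hw.add_ofReal_mem hv hs
  rw [(hh.hasDerivAt_Gop hw hv hint).deriv]
  refine hasSum_integral_flow (hh.summable.mul_left B)
    (integrableOn_rpow_sub one_pos (p := ν + 1) (by linarith [hw.exponent_pos]))
    (f := fun l s => deriv (fourierCoefC h l) (v + s)) (fun l => ?_) (fun l s hs => ?_)
    fun s hs => hh.hasSum_deriv hw (hmem s hs) _
  · exact ((hh.differentiableOn_coef hw l).deriv hw.isOpen).continuousOn.comp (by fun_prop) hmem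
  · rw [neg_add']
    exact (hbd _ _ (hh.differentiableOn_coef hw l) (hh.le l) v (Metric.mem_ball_self hε) s hs).2

lemma norm_integral_deriv_coef_le (hh : HasFourierBound D w h M) (hw : IsConeWeight D m ν C w)
    {v : ℂ} (hv : v ∈ D) (l : ℤ) (lam : ℝ) :
    ‖∫ s in Set.Iic (0 : ℝ), deriv (fourierCoefC h l) (v + s) * osc lam s‖
      ≤ (3 + (1 + m) / m + 2 * ((1 + m) / m) ^ 2) * (C * M l / w v) := by
  have hd := hh.differentiableOn_coef hw l
  refine norm_integral_deriv_mul_osc_le hw.isOpen hd hw.slope_pos (fun s hs => hw.add_mem v hv s hs)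
    (fun s hs => ?_) (integrableOn_deriv hw hd (hh.le l) hv) (tendsto_zero hw hd (hh.le l) hv) lam
  rw [le_div_iff₀ (hw.pos v hv)]
  have h1 := hh.le l _ (hw.add_mem v hv s hs)
  calc ‖fourierCoefC h l (v + s)‖ * w v
      ≤ ‖fourierCoefC h l (v + s)‖ * (C * w (v + s)) := by
        gcongr; exact hw.le_mul v hv s hs
    _ = C * (w (v + s) * ‖fourierCoefC h l (v + s)‖) := by ring
    _ ≤ C * M l := mul_le_mul_of_nonneg_left h1 hw.const_pos.le

/-- Integrability along a flow line does not depend on small displacements of its base point. -/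
lemma exists_ball_integrableOn_flow (hh : HasFourierBound D w h M) (hw : IsConeWeight D m ν C w)
    {v : ℂ} (hv : v ∈ D) :
    ∃ ε : ℝ, 0 < ε ∧ ∀ z ∈ Metric.ball v ε, ∀ γ ξ : ℝ,
      IntegrableOn (fun s : ℝ => h (z + s) (ξ + γ * s)) (Set.Iic 0) →
      IntegrableOn (fun s : ℝ => h (v + s) (ξ + γ * s)) (Set.Iic 0) := by
  obtain ⟨ε, hε, B, hB, hball, hbd⟩ := hw.exists_local_bounds hv
  refine ⟨ε, hε, fun z hz γ ξ hint => ?_⟩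
  have hvball := Metric.mem_ball_self (x := v) hε
  have key : IntegrableOn
      (fun s : ℝ => h (v + s) (ξ + γ * s) - h (z + s) (ξ + γ * s)) (Set.Iic 0) := by
    refine ((integrableOn_rpow_sub one_pos (p := ν + 1) (by linarith [hw.exponent_pos])).const_mul
      (B * (∑' l, M l) * ‖v - z‖)).mono' (((hh.continuousOn_flow hw hv γ ξ).sub
      (hh.continuousOn_flow hw (hball hz) γ ξ)).aestronglyMeasurable measurableSet_Iic) ?_
    filter_upwards [ae_restrict_mem measurableSet_Iic] with s hs
    have hd : ∀ x ∈ Metric.ball v ε,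
        DifferentiableAt ℂ (fun x : ℂ => h (x + (s : ℂ)) (ξ + γ * s)) x := fun x hx => by
      have hx' := hw.add_ofReal_mem (hball hx) hs
      exact DifferentiableAt.comp (g := fun y => h y (ξ + γ * s)) x
        ((hh.differentiableOn _).differentiableAt (hw.isOpen.mem_nhds hx')) (by fun_prop)
    have := (convex_ball v ε).norm_image_sub_le_of_norm_deriv_le hd
      (C := B * (∑' l, M l) * (1 - s) ^ (-ν - 1)) (fun x hx => ?_) hz hvball
    · rw [neg_add']
      refine this.trans_eq ?_
      ring
    · rw [deriv_comp_add_const (f := fun y => h y (ξ + γ * s))]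
      exact (hbd _ _ (hh.differentiableOn _) (hh.weight_mul_norm_le hw _) x hx s hs).2
  exact (key.add hint).congr (.of_forall fun s => by simp)

/-- For fixed `v`, integrability along flow lines does not depend on the angle. -/
lemma integrableOn_flow_of_angle (hh : HasFourierBound D w h M) (hw : IsConeWeight D m ν C w)
    {v : ℂ} (hv : v ∈ D) {γ : ℝ} (hγ : 0 < γ) {ξ : ℝ}
    (hint : IntegrableOn (fun s : ℝ => h (v + s) (ξ + γ * s)) (Set.Iic 0)) (η : ℝ) :
    IntegrableOn (fun s : ℝ => h (v + s) (η + γ * s)) (Set.Iic 0) := by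
  obtain ⟨ε, hε, hball⟩ := hh.exists_ball_integrableOn_flow hw hv
  have step : ∀ t : ℝ, 0 ≤ t → t < ε → ∀ ξ : ℝ,
      IntegrableOn (fun s : ℝ => h (v + s) (ξ + γ * s)) (Set.Iic 0) →
      IntegrableOn (fun s : ℝ => h (v + s) (ξ - γ * t + γ * s)) (Set.Iic 0) := by
    intro t ht htε ξ hξ
    refine hball (v - t) ?_ γ (ξ - γ * t) ?_
    · rw [mem_ball_iff_norm, sub_sub_cancel_left, norm_neg, Complex.norm_real,
        Real.norm_of_nonneg ht]
      exact htε
    · have h1 := (integrable_indicator_iff measurableSet_Iic).2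
        (hξ.mono_set (Set.Iic_subset_Iic.2 (neg_nonpos.2 ht)))
      refine ((h1.comp_sub_right t).integrableOn (s := Set.Iic 0)).congr_fun (fun s hs => ?_)
        measurableSet_Iic
      have hs' : s ≤ 0 := hs
      simp only [Set.indicator]
      rw [if_pos (show s - t ∈ Set.Iic (-t) by simpa using hs')]
      push_cast
      congr 1 <;> ring
  obtain ⟨k, hk⟩ := exists_nat_ge ((η - ξ) / (2 * Real.pi))
  rw [div_le_iff₀ Real.two_pi_pos] at hk
  set T := (ξ - η + k * (2 * Real.pi)) / γ with hT
  have hT0 : 0 ≤ T := div_nonneg (by linarith) hγ.le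
  obtain ⟨n, hn⟩ := exists_nat_gt (T / ε)
  have hn0 : (0 : ℝ) < n := (div_nonneg hT0 hε.le).trans_lt hn
  rw [div_lt_iff₀ hε] at hn
  have iter : ∀ j : ℕ,
      IntegrableOn (fun s : ℝ => h (v + s) (ξ - γ * (j * (T / n)) + γ * s)) (Set.Iic 0) := by
    intro j
    induction j with
    | zero => simpa using hint
    | succ j ih =>
      have := step (T / n) (by positivity) (by rw [div_lt_iff₀ hn0]; linarith) _ ih
      refine this.congr_fun (fun s _ => ?_) measurableSet_Iic
      push_cast
      congr 1; ring
  refine (iter n).congr_fun (fun s hs => ?_) measurableSet_Iic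
  have hper : Function.Periodic (h (v + s)) (2 * Real.pi) :=
    hh.periodic _ (hw.add_ofReal_mem hv hs)
  have e : ξ - γ * (n * (T / n)) + γ * s = η + γ * s - k * (2 * Real.pi) := by
    rw [hT]
    field_simp
    ring
  simp only
  rw [e]
  exact hper.sub_nat_mul_eq k

/-- The `v`-derivative of `Gop` loses no weight. This includes the case where the integrals
defining `Gop` diverge and `Gop` vanishes by convention. -/
theorem weight_mul_norm_coef_deriv_Gop_le (hh : HasFourierBound D w h M)
    (hw : IsConeWeight D m ν C w) {v : ℂ} (hv : v ∈ D) {G : ℝ} (hG : 0 < G) (l : ℤ) :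
    w v * ‖fourierCoefC (fun v ξ => deriv (fun z => Gop G h z ξ) v) l v‖
      ≤ (3 + (1 + m) / m + 2 * ((1 + m) / m) ^ 2) * C * M l := by
  have hm := hw.slope_pos
  have hC := hw.const_pos
  have hwv := hw.pos v hv
  have hM := hh.nonneg hw hv
  by_cases hint : ∃ ξ : ℝ,
      IntegrableOn (fun s : ℝ => h (v + s) (ξ + G ^ 3 * s)) (Set.Iic 0)
  · obtain ⟨ξ, hint⟩ := hint
    have hJ := fun l : ℤ => hh.norm_integral_deriv_coef_le hw hv l (l * G ^ 3)
    rw [fourierCoefC_eq_of_hasSum ?_ (fun η => hh.hasSum_deriv_Gop hw hv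
      (hh.integrableOn_flow_of_angle hw hv (pow_pos hG 3) hint η)) l]
    · refine (mul_le_mul_of_nonneg_left (hJ l) hwv.le).trans_eq ?_
      field_simp
    · exact (((hh.summable.mul_left C).div_const (w v)).mul_left _).of_nonneg_of_le
        (fun _ => norm_nonneg _) hJ
  · push Not at hint
    obtain ⟨ε, hε, hball⟩ := hh.exists_ball_integrableOn_flow hw hv
    have e : ∀ ξ, deriv (fun z => Gop G h z ξ) v = 0 := by
      intro ξ
      have : (fun z => Gop G h z ξ) =ᶠ[nhds v] fun _ => 0 :=
        Filter.eventually_of_mem (Metric.ball_mem_nhds v hε) fun z hz =>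
          integral_undef fun hi => hint ξ (hball z hz _ _ hi)
      rw [this.deriv_eq, deriv_const]
    have e' : fourierCoefC (fun v ξ => deriv (fun z => Gop G h z ξ) v) l v = 0 := by
      simp [fourierCoefC, e]
    rw [e', norm_zero, mul_zero]
    have := hM l
    positivity

variable {v : ℂ} {g : ℝ → ℝ}

lemma integrableOn_flow (hh : HasFourierBound D w h M) (hw : IsConeWeight D m ν C w)
    (hv : v ∈ D) (hg : IntegrableOn g (Set.Iic 0)) (hgw : ∀ s : ℝ, s ≤ 0 → 1 ≤ g s * w (v + s))
    (γ ξ : ℝ) : IntegrableOn (fun s : ℝ => h (v + s) (ξ + γ * s)) (Set.Iic 0) := by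
  refine (hg.const_mul (∑' l, M l)).mono'
    ((hh.continuousOn_flow hw hv γ ξ).aestronglyMeasurable measurableSet_Iic) ?_
  filter_upwards [ae_restrict_mem measurableSet_Iic] with s hs
  have hmem := hw.add_ofReal_mem hv hs
  exact norm_le_mul_of_one_le_mul (hw.pos _ hmem) (hgw s hs) (hh.weight_mul_norm_le hw _ _ hmem)

lemma norm_integral_coef_le (hh : HasFourierBound D w h M) (hw : IsConeWeight D m ν C w)
    (hv : v ∈ D) (hg : IntegrableOn g (Set.Iic 0)) (hgw : ∀ s : ℝ, s ≤ 0 → 1 ≤ g s * w (v + s))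
    (l : ℤ) (lam : ℝ) :
    ‖∫ s in Set.Iic (0 : ℝ), fourierCoefC h l (v + s) * osc lam s‖
      ≤ M l * ∫ s in Set.Iic (0 : ℝ), g s := by
  rw [← integral_const_mul]
  refine norm_integral_le_of_norm_le (hg.const_mul _) ?_
  filter_upwards [ae_restrict_mem measurableSet_Iic] with s hs
  have hmem := hw.add_ofReal_mem hv hs
  rw [norm_mul, norm_osc, mul_one]
  exact norm_le_mul_of_one_le_mul (hw.pos _ hmem) (hgw s hs) (hh.le l _ hmem)

lemma hasSum_Gop (hh : HasFourierBound D w h M) (hw : IsConeWeight D m ν C w)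
    (hv : v ∈ D) (hg : IntegrableOn g (Set.Iic 0)) (hgw : ∀ s : ℝ, s ≤ 0 → 1 ≤ g s * w (v + s))
    (G ξ : ℝ) :
    HasSum (fun l : ℤ => (∫ s in Set.Iic (0 : ℝ),
        fourierCoefC h l (v + s) * osc (l * G ^ 3) s) * osc l ξ) (Gop G h v ξ) := by
  have hmem : ∀ s ∈ Set.Iic (0 : ℝ), v + (s : ℂ) ∈ D := fun s hs => hw.add_ofReal_mem hv hs
  refine hasSum_integral_flow hh.summable hg (f := fun l s => fourierCoefC h l (v + s))
    (fun l => ?_) (fun l s hs => ?_) fun s hs => hh.hasSum hw (hmem s hs) _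
  · exact (hh.differentiableOn_coef hw l).continuousOn.comp (by fun_prop) hmem
  · exact norm_le_mul_of_one_le_mul (hw.pos _ (hmem s hs)) (hgw s hs) (hh.le l _ (hmem s hs))

lemma norm_coef_Gop_le (hh : HasFourierBound D w h M) (hw : IsConeWeight D m ν C w)
    (hv : v ∈ D) (hg : IntegrableOn g (Set.Iic 0)) (hgw : ∀ s : ℝ, s ≤ 0 → 1 ≤ g s * w (v + s))
    (G : ℝ) (l : ℤ) :
    ‖fourierCoefC (Gop G h) l v‖ ≤ M l * ∫ s in Set.Iic (0 : ℝ), g s := by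
  rw [fourierCoefC_eq_of_hasSum ?_ (hh.hasSum_Gop hw hv hg hgw G)]
  · exact hh.norm_integral_coef_le hw hv hg hgw l _
  · exact (hh.summable.mul_right _).of_nonneg_of_le (fun _ => norm_nonneg _)
      fun l => hh.norm_integral_coef_le hw hv hg hgw l _

/-- `Gop` inverts `∂_v + G³ ∂_ξ`. -/
theorem deriv_Gop_add_deriv_Gop (hh : HasFourierBound D w h M) (hw : IsConeWeight D m ν C w)
    (hM : Summable fun l : ℤ => |(l : ℝ)| * M l)
    (hv : v ∈ D) (hg : IntegrableOn g (Set.Iic 0)) (hgw : ∀ s : ℝ, s ≤ 0 → 1 ≤ g s * w (v + s))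
    (G ξ : ℝ) :
    deriv (fun z => Gop G h z ξ) v + (G : ℂ) ^ 3 * deriv (fun η => Gop G h v η) ξ = h v ξ := by
  set c : ℤ → ℂ := fun l => ∫ s in Set.Iic (0 : ℝ),
    fourierCoefC h l (v + s) * osc (l * G ^ 3) s with hc
  have hcle : ∀ l, ‖c l‖ ≤ M l * ∫ s in Set.Iic (0 : ℝ), g s := fun l =>
    hh.norm_integral_coef_le hw hv hg hgw l _
  have hGop : (fun η => Gop G h v η) = fun η => ∑' l : ℤ, c l * osc l η :=
    funext fun η => (hh.hasSum_Gop hw hv hg hgw G η).tsum_eq.symm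
  have hbound : ∀ (l : ℤ) (η : ℝ), ‖c l * (l * Complex.I * osc l η)‖
      ≤ |(l : ℝ)| * M l * ∫ s in Set.Iic (0 : ℝ), g s := fun l η => by
    rw [norm_mul, norm_mul, norm_mul, norm_osc, Complex.norm_I, mul_one, mul_one,
      Complex.norm_intCast, mul_comm, mul_assoc]
    exact mul_le_mul_of_nonneg_left (hcle l) (abs_nonneg _)
  have hosc : ∀ (l : ℤ) (η : ℝ),
      HasDerivAt (fun η => c l * osc l η) (c l * (l * Complex.I * osc l η)) η := fun l η => by
    simpa using (hasDerivAt_osc l η).const_mul (c l)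
  have hderiv : HasDerivAt (fun η => Gop G h v η)
      (∑' l : ℤ, c l * (l * Complex.I * osc l ξ)) ξ := by
    rw [hGop]
    exact hasDerivAt_tsum (hM.mul_right _) hosc hbound
      (hh.hasSum_Gop hw hv hg hgw G 0).summable ξ
  have hξ : HasSum (fun l : ℤ => c l * (l * Complex.I * osc l ξ))
      (deriv (fun η => Gop G h v η) ξ) := by
    rw [hderiv.deriv]
    exact ((hM.mul_right _).of_norm_bounded fun l => hbound l ξ).hasSum
  have hsum := (hh.hasSum_deriv_Gop hw hv (hh.integrableOn_flow hw hv hg hgw (G ^ 3) ξ)).add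
    (hξ.mul_left ((G : ℂ) ^ 3))
  refine (hsum.congr_fun fun l => ?_).unique (hh.hasSum hw hv ξ)
  have hd := hh.differentiableOn_coef hw l
  have hci : IntegrableOn (fun s : ℝ => fourierCoefC h l (v + s)) (Set.Iic 0) := by
    refine (hg.const_mul (M l)).mono' ((hd.continuousOn.comp (by fun_prop)
      fun s hs => hw.add_ofReal_mem hv hs).aestronglyMeasurable measurableSet_Iic) ?_
    filter_upwards [ae_restrict_mem measurableSet_Iic] with s hs
    have hmem := hw.add_ofReal_mem hv hs
    exact norm_le_mul_of_one_le_mul (hw.pos _ hmem) (hgw s hs) (hh.le l _ hmem)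
  rw [integral_deriv_mul_osc hw.isOpen hd (fun s hs => hw.add_ofReal_mem hv hs) (.inr hci)
    (integrableOn_deriv hw hd (hh.le l) hv) (tendsto_zero hw hd (hh.le l) hv)]
  have : osc (l * G ^ 3) 0 = 1 := by simp [osc]
  simp only [this, hc]
  push_cast
  rw [add_zero]
  ring

end HasFourierBound

/-! ### The domain `domD` and its weighted norms -/

section Domain

variable {β₁ β₂ κ δ G ρ σ ν μ : ℝ}

lemma domD_subset_roofRegion (hκ : 0 < κ) (hG : 0 < G) :
    domD β₁ β₂ κ δ G ⊆ roofRegion (Real.tan β₁) := by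
  rintro v ⟨h1, -⟩
  have : 0 < κ / G ^ 3 := by positivity
  change |v.im| < 1 / 3 - Real.tan β₁ * v.re
  linarith

lemma isOpen_domD : IsOpen (domD β₁ β₂ κ δ G) :=
  IsOpen.inter
    (isOpen_lt (f := fun v : ℂ => |v.im|)
      (g := fun v => -Real.tan β₁ * v.re + 1 / 3 - κ / G ^ 3) (by fun_prop) (by fun_prop))
    (isOpen_lt (f := fun v : ℂ => Real.tan β₂ * v.re + 1 / 6 - δ) (g := fun v => |v.im|)
      (by fun_prop) (by fun_prop))

lemma add_leftCone_mem_domD {m : ℝ} (hm : 0 < m) (hm₁ : m ≤ Real.tan β₁) (hm₂ : m ≤ Real.tan β₂)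
    {v s : ℂ} (hv : v ∈ domD β₁ β₂ κ δ G) (hs : s ∈ leftCone m) : v + s ∈ domD β₁ β₂ κ δ G := by
  obtain ⟨h1, h2⟩ := hv
  have h3 : |s.im| ≤ -m * s.re := hs
  have h0 := re_nonpos_of_mem_leftCone hm hs
  have h4 := abs_add_le v.im s.im
  have h5 : |v.im| ≤ |v.im + s.im| + |s.im| := by
    simpa using abs_sub (v.im + s.im) s.im
  constructor <;> simp only [Complex.add_re, Complex.add_im]
  · nlinarith
  · nlinarith

lemma domD_nonempty (ht₁ : 0 < Real.tan β₁) (ht₂ : 0 < Real.tan β₂) (hδ : 0 < δ)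
    (hG : κ / G ^ 3 < 1 / 3) : (domD β₁ β₂ κ δ G).Nonempty := by
  refine ⟨((-(1 / (3 * Real.tan β₂)) : ℝ) : ℂ), ?_, ?_⟩ <;>
    rw [Complex.ofReal_re, Complex.ofReal_im, abs_zero]
  · have : 0 < Real.tan β₁ * (1 / (3 * Real.tan β₂)) := by positivity
    linarith
  · have : Real.tan β₂ * -(1 / (3 * Real.tan β₂)) = -(1 / 3) := by field_simp
    linarith

lemma ofReal_wt_mul_le_coefWNorm (f : ℂ → ℂ) {v : ℂ} (hv : v ∈ domD β₁ β₂ κ δ G) :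
    ENNReal.ofReal (wt ρ ν μ v * ‖f v‖)
      ≤ coefWNorm (domD β₁ β₂ κ δ G) (domDr β₁ β₂ κ δ G ρ) ν μ f := by
  unfold coefWNorm
  rcases le_or_gt v.re (-ρ) with h | h
  · rw [wt_of_le h]
    refine le_add_right (le_iSup₂ (f := fun v _ => ENNReal.ofReal (‖v‖ ^ ν * ‖f v‖)) v ⟨hv, ?_⟩)
    exact fun hr => (not_lt.2 h) hr.2
  · rw [wt_of_lt h]
    exact le_add_left (le_iSup₂
      (f := fun v _ => ENNReal.ofReal (‖v ^ 2 + 1 / 9‖ ^ μ * ‖f v‖)) v ⟨hv, h⟩)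

lemma coefWNorm_le {f : ℂ → ℂ} {A : ℝ}
    (hf : ∀ v ∈ domD β₁ β₂ κ δ G, wt ρ ν μ v * ‖f v‖ ≤ A) :
    coefWNorm (domD β₁ β₂ κ δ G) (domDr β₁ β₂ κ δ G ρ) ν μ f ≤ 2 * ENNReal.ofReal A := by
  unfold coefWNorm
  rw [two_mul]
  refine add_le_add (iSup₂_le fun v hv => ENNReal.ofReal_le_ofReal ?_)
    (iSup₂_le fun v hv => ENNReal.ofReal_le_ofReal ?_)
  · rw [← wt_of_le (μ := μ) (not_lt.1 fun h => hv.2 ⟨hv.1, h⟩)]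
    exact hf v hv.1
  · rw [← wt_of_lt (ν := ν) hv.2]
    exact hf v hv.1

variable {h : ℂ → ℝ → ℂ}

lemma coefWNorm_ne_top_of_wNorm_lt_top {D Dr : Set ℂ} (hfin : wNorm D Dr σ ν μ h < ⊤) (l : ℤ) :
    coefWNorm D Dr ν μ (fourierCoefC h l) ≠ ⊤ := fun htop => by
  refine ENNReal.ne_top_of_tsum_ne_top hfin.ne l ?_
  rw [htop, ENNReal.top_mul]
  simpa using Real.exp_pos _

lemma summable_toReal_coefWNorm {D Dr : Set ℂ} (hfin : wNorm D Dr σ ν μ h < ⊤) :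
    Summable fun l : ℤ => (coefWNorm D Dr ν μ (fourierCoefC h l)).toReal *
      Real.exp (|(l : ℝ)| * σ) := by
  refine (ENNReal.summable_toReal hfin.ne).congr fun l => ?_
  rw [ENNReal.toReal_mul, ENNReal.toReal_ofReal (Real.exp_pos _).le]

lemma summable_abs_mul_toReal_coefWNorm {D Dr : Set ℂ} (hσ : 0 < σ)
    (hfin : wNorm D Dr σ ν μ h < ⊤) :
    Summable fun l : ℤ => |(l : ℝ)| * (coefWNorm D Dr ν μ (fourierCoefC h l)).toReal := by
  refine ((summable_toReal_coefWNorm hfin).mul_left σ⁻¹).of_nonneg_of_le (fun l => by positivity)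
    fun l => ?_
  have h1 : |(l : ℝ)| ≤ σ⁻¹ * Real.exp (|(l : ℝ)| * σ) := by
    rw [← div_eq_inv_mul, le_div_iff₀ hσ]
    linarith [Real.add_one_le_exp (|(l : ℝ)| * σ)]
  calc _ ≤ σ⁻¹ * Real.exp (|(l : ℝ)| * σ) * (coefWNorm D Dr ν μ (fourierCoefC h l)).toReal := by
        gcongr
    _ = _ := by ring

lemma wNorm_le_of_forall_coef {h' : ℂ → ℝ → ℂ} {ν' μ' K : ℝ} (hK : 0 ≤ K)
    (hfin : wNorm (domD β₁ β₂ κ δ G) (domDr β₁ β₂ κ δ G ρ) σ ν μ h < ⊤)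
    (hle : ∀ l : ℤ, ∀ v ∈ domD β₁ β₂ κ δ G, wt ρ ν' μ' v * ‖fourierCoefC h' l v‖ ≤ K *
      (coefWNorm (domD β₁ β₂ κ δ G) (domDr β₁ β₂ κ δ G ρ) ν μ (fourierCoefC h l)).toReal) :
    wNorm (domD β₁ β₂ κ δ G) (domDr β₁ β₂ κ δ G ρ) σ ν' μ' h' ≤
      ENNReal.ofReal (2 * K) * wNorm (domD β₁ β₂ κ δ G) (domDr β₁ β₂ κ δ G ρ) σ ν μ h := by
  unfold wNorm
  rw [← ENNReal.tsum_mul_left]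
  refine ENNReal.tsum_le_tsum fun l => ?_
  rw [← mul_assoc]
  gcongr
  refine (coefWNorm_le (hle l)).trans_eq ?_
  rw [ENNReal.ofReal_mul hK, ENNReal.ofReal_toReal (coefWNorm_ne_top_of_wNorm_lt_top hfin l),
    ENNReal.ofReal_mul zero_le_two, ENNReal.ofReal_ofNat, mul_assoc]

lemma hasFourierBound_domD (hσ : 0 < σ)
    (hdiff : ∀ ξ : ℝ, DifferentiableOn ℂ (fun v => h v ξ) (domD β₁ β₂ κ δ G))
    (hcont : ∀ v ∈ domD β₁ β₂ κ δ G, Continuous (h v))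
    (hper : ∀ v ∈ domD β₁ β₂ κ δ G, ∀ ξ : ℝ, h v (ξ + 2 * Real.pi) = h v ξ)
    (hfin : wNorm (domD β₁ β₂ κ δ G) (domDr β₁ β₂ κ δ G ρ) σ ν μ h < ⊤) :
    HasFourierBound (domD β₁ β₂ κ δ G) (wt ρ ν μ) h fun l =>
      (coefWNorm (domD β₁ β₂ κ δ G) (domDr β₁ β₂ κ δ G ρ) ν μ (fourierCoefC h l)).toReal where
  differentiableOn := hdiff
  continuous := hcont
  periodic := hper
  summable := (summable_toReal_coefWNorm hfin).of_nonneg_of_le (fun _ => ENNReal.toReal_nonneg)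
    fun l => le_mul_of_one_le_right ENNReal.toReal_nonneg (Real.one_le_exp (by positivity))
  le l v hv := (ENNReal.ofReal_le_iff_le_toReal (coefWNorm_ne_top_of_wNorm_lt_top hfin l)).1
    (ofReal_wt_mul_le_coefWNorm _ hv)

lemma exists_isConeWeight_domD (ht₁ : 0 < Real.tan β₁) (ht₂ : 0 < Real.tan β₂) (hκ : 0 < κ)
    (hρ : 0 < ρ) (hν : 0 < ν) (hμ : 0 ≤ μ) :
    ∃ m : ℝ, 0 < m ∧ ∃ C : ℝ, 0 < C ∧ ∀ G : ℝ, 0 < G →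
      IsConeWeight (domD β₁ β₂ κ δ G) m ν C (wt ρ ν μ) := by
  have hm : 0 < min (Real.tan β₁) (Real.tan β₂) / 2 := half_pos (lt_min ht₁ ht₂)
  have h₁ := min_le_left (Real.tan β₁) (Real.tan β₂)
  have h₂ := min_le_right (Real.tan β₁) (Real.tan β₂)
  have hmt : min (Real.tan β₁) (Real.tan β₂) / 2 ≤ Real.tan β₁ / 2 := by linarith
  obtain ⟨C, hC, hCw⟩ := wt_le_mul_wt_add (ρ := ρ) ht₁ hm hmt hρ hν.le hμ
  refine ⟨_, hm, C, hC, fun G hG => ?_⟩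
  have hsub := domD_subset_roofRegion (β₁ := β₁) (β₂ := β₂) (δ := δ) hκ hG
  exact
    { isOpen := isOpen_domD
      slope_pos := hm
      exponent_pos := hν
      const_pos := hC
      add_mem := fun v hv s hs =>
        add_leftCone_mem_domD hm (by linarith) (by linarith) hv hs
      pos := fun v hv => wt_pos hρ (hsub hv)
      le_mul := fun v hv => hCw v (hsub hv)
      decay := fun v hv => rpow_one_sub_re_le_mul_wt ht₁ hm hmt hρ hν.le hμ (hsub hv) }

end Domain

theorem inverse_operator_estimates
    (β₁ β₂ δ κ σ ρ ν μ : ℝ)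
    (hβ₁ : β₁ ∈ Set.Ioo 0 (Real.pi / 2)) (hβ₂ : β₂ ∈ Set.Ioo 0 (Real.pi / 2))
    (hδ : δ ∈ Set.Ioo 0 (1 / 12)) (hκ : 0 < κ) (hσ : 0 < σ) (hρ : 0 < ρ) :
    ∃ K : ℝ, 0 < K ∧ ∃ G₀ : ℝ, 0 < G₀ ∧ ∀ G : ℝ, G₀ ≤ G →
      (domD β₁ β₂ κ δ G).Nonempty ∧
      ∀ h : ℂ → ℝ → ℂ,
        (∀ ξ : ℝ, DifferentiableOn ℂ (fun v => h v ξ) (domD β₁ β₂ κ δ G)) →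
        (∀ v ∈ domD β₁ β₂ κ δ G, Continuous (h v)) →
        (∀ v ∈ domD β₁ β₂ κ δ G, ∀ ξ : ℝ, h v (ξ + 2 * Real.pi) = h v ξ) →
        -- (i): for ν > 1, μ > 1, 𝒢(h) is well defined, holomorphic, a right inverse
        -- of ℒ = ∂_v + G³∂_ξ, and ‖𝒢(h)‖_{ν−1,μ−1} ≤ K ‖h‖_{ν,μ};
        ((1 < ν → 1 < μ →
          wNorm (domD β₁ β₂ κ δ G) (domDr β₁ β₂ κ δ G ρ) σ ν μ h < ⊤ →
          (∀ v ∈ domD β₁ β₂ κ δ G, ∀ ξ : ℝ,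
            IntegrableOn (fun s : ℝ => h (v + (s : ℂ)) (ξ + G ^ 3 * s)) (Set.Iic 0)) ∧
          (∀ ξ : ℝ, DifferentiableOn ℂ (fun v => Gop G h v ξ) (domD β₁ β₂ κ δ G)) ∧
          (∀ v ∈ domD β₁ β₂ κ δ G, ∀ ξ : ℝ,
            deriv (fun z => Gop G h z ξ) v + (G : ℂ) ^ 3 * deriv (fun η => Gop G h v η) ξ
              = h v ξ) ∧
          wNorm (domD β₁ β₂ κ δ G) (domDr β₁ β₂ κ δ G ρ) σ (ν - 1) (μ - 1) (Gop G h)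
            ≤ ENNReal.ofReal K *
              wNorm (domD β₁ β₂ κ δ G) (domDr β₁ β₂ κ δ G ρ) σ ν μ h) ∧
        -- (ii): for ν ≥ 1, μ ≥ 1, ‖∂_v 𝒢(h)‖_{ν,μ} ≤ K ‖h‖_{ν,μ}.
        (1 ≤ ν → 1 ≤ μ →
          wNorm (domD β₁ β₂ κ δ G) (domDr β₁ β₂ κ δ G ρ) σ ν μ h < ⊤ →
          wNorm (domD β₁ β₂ κ δ G) (domDr β₁ β₂ κ δ G ρ) σ ν μ
              (fun v ξ => deriv (fun z => Gop G h z ξ) v)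
            ≤ ENNReal.ofReal K *
              wNorm (domD β₁ β₂ κ δ G) (domDr β₁ β₂ κ δ G ρ) σ ν μ h)) := by
  have ht₁ : 0 < Real.tan β₁ := Real.tan_pos_of_pos_of_lt_pi_div_two hβ₁.1 hβ₁.2
  have ht₂ : 0 < Real.tan β₂ := Real.tan_pos_of_pos_of_lt_pi_div_two hβ₂.1 hβ₂.2
  obtain ⟨K₁, hK₁, hmaj⟩ : ∃ K : ℝ, 0 < K ∧ (1 < ν → 1 < μ → ∀ v ∈ roofRegion (Real.tan β₁),
      ∃ g : ℝ → ℝ, IntegrableOn g (Set.Iic 0) ∧ (∀ s : ℝ, s ≤ 0 → 1 ≤ g s * wt ρ ν μ (v + s)) ∧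
        wt ρ (ν - 1) (μ - 1) v * ∫ s in Set.Iic (0 : ℝ), g s ≤ K) := by
    by_cases hνμ : 1 < ν ∧ 1 < μ
    · obtain ⟨K, hK, h⟩ := exists_integrable_majorant ht₁ hρ hνμ.1 hνμ.2
      exact ⟨K, hK, fun _ _ => h⟩
    · exact ⟨1, one_pos, fun hν hμ => (hνμ ⟨hν, hμ⟩).elim⟩
  obtain ⟨m, hm, C, hC, hcone⟩ : ∃ m : ℝ, 0 < m ∧ ∃ C : ℝ, 0 < C ∧ (1 ≤ ν → 1 ≤ μ → ∀ G : ℝ,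
      0 < G → IsConeWeight (domD β₁ β₂ κ δ G) m ν C (wt ρ ν μ)) := by
    by_cases hνμ : 1 ≤ ν ∧ 1 ≤ μ
    · obtain ⟨m, hm, C, hC, h⟩ := exists_isConeWeight_domD (δ := δ) ht₁ ht₂ hκ hρ
        (one_pos.trans_le hνμ.1) (zero_le_one.trans hνμ.2)
      exact ⟨m, hm, C, hC, fun _ _ => h⟩
    · exact ⟨1, one_pos, 1, one_pos, fun hν hμ => (hνμ ⟨hν, hμ⟩).elim⟩
  set K₂ := (3 + (1 + m) / m + 2 * ((1 + m) / m) ^ 2) * C with hK₂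
  have hK₂0 : 0 < K₂ := by positivity
  have hmono : ∀ K : ℝ, K ≤ K₁ + K₂ → ∀ x : ℝ≥0∞,
      ENNReal.ofReal (2 * K) * x ≤ ENNReal.ofReal (2 * (K₁ + K₂)) * x := fun K hK x => by
    gcongr
  refine ⟨2 * (K₁ + K₂), by positivity, 1 + 3 * κ, by positivity, fun G hG => ?_⟩
  have hG0 : 0 < G := by linarith
  have hκG : κ / G ^ 3 < 1 / 3 := by
    have : G ≤ G ^ 3 := le_self_pow₀ (by linarith) (by norm_num)
    rw [div_lt_iff₀ (by positivity)]
    linarith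
  refine ⟨domD_nonempty ht₁ ht₂ hδ.1 hκG, fun h hdiff hcont hper => ⟨fun hν hμ hfin => ?_,
    fun hν hμ hfin => ?_⟩⟩
  · have hw := hcone hν.le hμ.le G hG0
    have hh := hasFourierBound_domD hσ hdiff hcont hper hfin
    have hmaj' := fun v hv => hmaj hν hμ v (domD_subset_roofRegion (β₂ := β₂) (δ := δ) hκ hG0 hv)
    have hint : ∀ v ∈ domD β₁ β₂ κ δ G, ∀ ξ : ℝ,
        IntegrableOn (fun s : ℝ => h (v + (s : ℂ)) (ξ + G ^ 3 * s)) (Set.Iic 0) := fun v hv ξ => by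
      obtain ⟨g, hg, hgw, -⟩ := hmaj' v hv
      exact hh.integrableOn_flow hw hv hg hgw _ ξ
    refine ⟨hint, fun ξ v hv => ?_, fun v hv ξ => ?_, ?_⟩
    · exact (hh.hasDerivAt_Gop hw hv (hint v hv ξ)).differentiableAt.differentiableWithinAt
    · obtain ⟨g, hg, hgw, -⟩ := hmaj' v hv
      exact hh.deriv_Gop_add_deriv_Gop hw (summable_abs_mul_toReal_coefWNorm hσ hfin) hv hg hgw G ξ
    · refine (wNorm_le_of_forall_coef hK₁.le hfin fun l v hv => ?_).trans
        (hmono K₁ (by linarith) _)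
      obtain ⟨g, hg, hgw, hgK⟩ := hmaj' v hv
      calc _ ≤ wt ρ (ν - 1) (μ - 1) v * (_ * ∫ s in Set.Iic (0 : ℝ), g s) :=
            mul_le_mul_of_nonneg_left (hh.norm_coef_Gop_le hw hv hg hgw G l) (wt_nonneg _ _ _ _)
        _ = (wt ρ (ν - 1) (μ - 1) v * ∫ s in Set.Iic (0 : ℝ), g s) * _ := by ring
        _ ≤ _ := mul_le_mul_of_nonneg_right hgK ENNReal.toReal_nonneg
  · have hw := hcone hν hμ G hG0
    have hh := hasFourierBound_domD hσ hdiff hcont hper hfin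
    exact (wNorm_le_of_forall_coef hK₂0.le hfin fun l v hv =>
      hh.weight_mul_norm_coef_deriv_Gop_le hw hv hG0 l).trans (hmono K₂ (by linarith) _)
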